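/- arXiv:1405.7647 — 4 statements merged into one kernel-verified Lean document; each statement's English description precedes it below -/
import Mathlib

section
/- Let S ⊆ ℤ^n be a finite nonempty set and let P = conv(S) be the polytope with integer vertices it spans. Then there exists a polynomial p with rational coefficients such that for every positive integer k, p(k) equals the number of points of ℤ^n contained in the dilate k·P. -/
open scoped Pointwise

/-- Every nonempty compact set of real tuples has a lexicographically minimal element. -/
lemma IsCompact.exists_lex_minimal {m : ℕ} {K : Set (Fin m → ℝ)} (hK : IsCompact K)
    (hne : K.Nonempty) : ∃ c ∈ K, ∀ d ∈ K, ¬ toLex d < toLex c := by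
  have key : ∀ j ≤ m, ∃ K' ⊆ K, IsCompact K' ∧ K'.Nonempty ∧ ∀ c ∈ K', ∀ d ∈ K,
      (d ∈ K' ∧ ∀ i : Fin m, i.val < j → c i = d i) ∨ toLex c < toLex d := by
    intro j
    induction j with
    | zero => exact fun _ => ⟨K, subset_rfl, hK, hne, fun c _ d hd => Or.inl ⟨hd, by simp⟩⟩
    | succ j ih =>
      intro hj
      obtain ⟨K', hsub, hK', hne', h⟩ := ih (by omega)
      let i₀ : Fin m := ⟨j, by omega⟩
      obtain ⟨c₀, hc₀, hmin⟩ :=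
        hK'.exists_isMinOn hne' (continuous_apply i₀).continuousOn
      refine ⟨K' ∩ {x | x i₀ = c₀ i₀}, fun x hx => hsub hx.1,
        hK'.inter_right (isClosed_eq (continuous_apply i₀) continuous_const),
        ⟨c₀, hc₀, rfl⟩, ?_⟩
      rintro c ⟨hc, hci⟩ d hd
      rcases h c hc d hd with ⟨hdK, hcd⟩ | hlt
      · have hle : c₀ i₀ ≤ d i₀ := hmin hdK
        have hci' : c i₀ = c₀ i₀ := hci
        rcases hle.eq_or_lt with heq | hlt
        · refine Or.inl ⟨⟨hdK, heq.symm⟩, fun i hi => ?_⟩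
          rcases Nat.lt_succ_iff_lt_or_eq.1 hi with hi | hi
          · exact hcd i hi
          · obtain rfl : i = i₀ := Fin.ext hi
            exact hci'.trans heq
        · exact Or.inr ⟨i₀, fun i hi => hcd i hi, show c i₀ < d i₀ by rwa [hci']⟩
      · exact Or.inr hlt
  obtain ⟨K', hsub, -, ⟨c, hc⟩, h⟩ := key m le_rfl
  refine ⟨c, hsub hc, fun d hd hlt => ?_⟩
  rcases h c hc d hd with ⟨-, hcd⟩ | hlt₂
  · obtain rfl : c = d := funext fun i => hcd i i.isLt
    exact lt_irrefl _ hlt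
  · exact lt_asymm hlt hlt₂

/-- `c` is the lexicographically smallest nonnegative tuple with its image under `A`. -/
def IsLexMin {m : ℕ} {E : Type*} [AddCommGroup E] [Module ℝ E] (A : (Fin m → ℝ) →ₗ[ℝ] E)
    (c : Fin m → ℝ) : Prop :=
  0 ≤ c ∧ ∀ d, 0 ≤ d → A d = A c → ¬ toLex d < toLex c

section LexMin

variable {m : ℕ} {E : Type*} [AddCommGroup E] [Module ℝ E] {A : (Fin m → ℝ) →ₗ[ℝ] E}

lemma IsLexMin.eq_of_map_eq {c d : Fin m → ℝ} (hc : IsLexMin A c) (hd : IsLexMin A d)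
    (h : A c = A d) : c = d := by
  rcases lt_trichotomy (toLex c) (toLex d) with hlt | heq | hlt
  · exact absurd hlt (hd.2 c hc.1 h)
  · exact toLex_inj.1 heq
  · exact absurd hlt (hc.2 d hd.1 h.symm)

/-- Lexicographic minimality depends only on the support, and passes to smaller supports. -/
lemma IsLexMin.of_support {c c' : Fin m → ℝ} (hc : IsLexMin A c) (hc' : 0 ≤ c')
    (hsupp : ∀ i, c i = 0 → c' i = 0) : IsLexMin A c' := by
  refine ⟨hc', fun d hd hAd hlt => ?_⟩
  obtain ⟨ε, hε, hle⟩ : ∃ ε : ℝ, 0 < ε ∧ ∀ i, ε * c' i ≤ c i := by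
    have h : ∀ i, ∀ᶠ ε : ℝ in nhdsWithin 0 (Set.Ioi 0), ε * c' i ≤ c i := by
      intro i
      rcases (hc.1 i).eq_or_lt with h0 | h0
      · simp [hsupp i h0.symm, ← h0]
      · have ht : Filter.Tendsto (fun ε : ℝ => ε * c' i) (nhdsWithin 0 (Set.Ioi 0))
            (nhds (0 * c' i)) :=
          ((continuous_id.mul continuous_const).tendsto (0 : ℝ)).mono_left nhdsWithin_le_nhds
        rw [zero_mul] at ht
        exact (ht.eventually_lt_const h0).mono fun _ h => h.le
    obtain ⟨ε, h1, h2⟩ := ((Filter.eventually_all.2 h).and self_mem_nhdsWithin).exists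
    exact ⟨ε, h2, h1⟩
  refine hc.2 (c + ε • (d - c')) (fun i => ?_) (by simp [hAd]) ?_
  · have h1 := hle i
    have h2 : 0 ≤ ε * d i := mul_nonneg hε.le (hd i)
    simp only [Pi.zero_apply, Pi.add_apply, Pi.smul_apply, Pi.sub_apply, smul_eq_mul]
    linarith
  · obtain ⟨i, hi, hlt⟩ := hlt
    refine ⟨i, fun j hj => ?_, ?_⟩
    · have : d j = c' j := hi j hj
      simp [this]
    · have : d i < c' i := hlt
      have := mul_pos hε (sub_pos.2 this)
      change c i + ε * (d i - c' i) < c i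
      linarith

end LexMin

/-- The coefficient tuple `c` is sent to the combination of the `v i` with coefficients `c i`,
together with the sum of the coefficients. -/
noncomputable def coneMap {m n : ℕ} (v : Fin m → Fin n → ℤ) :
    (Fin m → ℝ) →ₗ[ℝ] (Fin n → ℝ) × ℝ :=
  Fintype.linearCombination ℝ fun i => ((fun j => (v i j : ℝ)), (1 : ℝ))

/-- The lexicographically minimal representations of the lattice points at height `k`. -/
def lexReps {m n : ℕ} (v : Fin m → Fin n → ℤ) (k : ℕ) : Set (Fin m → ℝ) :=
  {c | IsLexMin (coneMap v) c ∧ ∃ x : Fin n → ℤ, coneMap v c = ((fun j => (x j : ℝ)), (k : ℝ))}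

section LexReps

variable {m n : ℕ} (v : Fin m → Fin n → ℤ)

lemma coneMap_fst (c : Fin m → ℝ) (j : Fin n) : (coneMap v c).1 j = ∑ i, c i * v i j := by
  simp [coneMap, Fintype.linearCombination_apply, Prod.fst_sum]

lemma coneMap_snd (c : Fin m → ℝ) : (coneMap v c).2 = ∑ i, c i := by
  simp [coneMap, Fintype.linearCombination_apply, Prod.snd_sum]

lemma coneMap_eq_iff (c : Fin m → ℝ) (x : Fin n → ℝ) (k : ℝ) :
    coneMap v c = (x, k) ↔ (∀ j, ∑ i, c i * v i j = x j) ∧ ∑ i, c i = k := by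
  rw [Prod.ext_iff, funext_iff, coneMap_snd]
  simp only [coneMap_fst]

lemma coneMap_natCast (f : Fin m → ℕ) :
    coneMap v (fun i => (f i : ℝ)) =
      ((fun j => ((∑ i, (f i : ℤ) * v i j : ℤ) : ℝ)), ((∑ i, f i : ℕ) : ℝ)) := by
  rw [coneMap_eq_iff]
  simp

lemma exists_isLexMin_coneMap {c : Fin m → ℝ} (hc : 0 ≤ c) :
    ∃ d, IsLexMin (coneMap v) d ∧ coneMap v d = coneMap v c := by
  have hK : IsCompact {d : Fin m → ℝ | 0 ≤ d ∧ coneMap v d = coneMap v c} := by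
    refine (isCompact_Icc (a := (0 : Fin m → ℝ)) (b := fun _ => ∑ i, c i)).of_isClosed_subset
      (isClosed_Ici.inter (isClosed_eq (coneMap v).continuous_of_finiteDimensional
        continuous_const)) ?_
    rintro d ⟨hd, hdc⟩
    refine ⟨hd, fun i => ?_⟩
    have : ∑ i, d i = ∑ i, c i := by rw [← coneMap_snd v, hdc, coneMap_snd]
    show d i ≤ ∑ i, c i
    rw [← this]
    exact Finset.single_le_sum (fun j _ => hd j) (Finset.mem_univ i)
  obtain ⟨d, hd, hmin⟩ := hK.exists_lex_minimal ⟨c, hc, rfl⟩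
  exact ⟨d, ⟨hd.1, fun e he hed => hmin e ⟨he, hed.trans hd.2⟩⟩, hd.2⟩

lemma injOn_coneMap_lexReps (k : ℕ) : Set.InjOn (coneMap v) (lexReps v k) :=
  fun _ hc _ hd h => hc.1.eq_of_map_eq hd.1 h

lemma finite_lexReps (k : ℕ) : (lexReps v k).Finite := by
  refine Set.Finite.of_finite_image ?_ (injOn_coneMap_lexReps v k)
  let M : Fin n → ℤ := fun j => k * ∑ i, |v i j|
  refine ((Set.finite_Icc (-M) M).image
    fun x : Fin n → ℤ => ((fun j => (x j : ℝ)), (k : ℝ))).subset ?_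
  rintro _ ⟨c, ⟨hc, x, hx⟩, rfl⟩
  refine ⟨x, ?_, hx.symm⟩
  rw [coneMap_eq_iff] at hx
  have hb : ∀ j, |x j| ≤ M j := by
    intro j
    have hreal : |(x j : ℝ)| ≤ k * ∑ i, |(v i j : ℝ)| := by
      rw [← hx.1 j, Finset.mul_sum]
      refine (Finset.abs_sum_le_sum_abs _ _).trans (Finset.sum_le_sum fun i _ => ?_)
      rw [abs_mul, abs_of_nonneg (hc.1 i), ← hx.2]
      exact mul_le_mul_of_nonneg_right
        (Finset.single_le_sum (fun j _ => hc.1 j) (Finset.mem_univ i)) (abs_nonneg _)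
    exact_mod_cast hreal
  exact ⟨fun j => (abs_le.1 (hb j)).1, fun j => (abs_le.1 (hb j)).2⟩

lemma mem_smul_convexHull_range_iff {k : ℕ} (hk : 0 < k) (x : Fin n → ℝ) :
    x ∈ (k : ℝ) • convexHull ℝ (Set.range fun i => fun j => (v i j : ℝ)) ↔
      ∃ c, 0 ≤ c ∧ coneMap v c = (x, (k : ℝ)) := by
  have hk' : (0 : ℝ) < k := by exact_mod_cast hk
  constructor
  · rintro ⟨y, hy, rfl⟩
    rw [convexHull_range_eq_exists_affineCombination] at hy
    obtain ⟨s, w, hw0, hw1, rfl⟩ := hy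
    refine ⟨fun i => if i ∈ s then k * w i else 0, fun i => ?_, ?_⟩
    · by_cases hi : i ∈ s
      · simpa [hi] using mul_nonneg hk'.le (hw0 i hi)
      · simp [hi]
    · rw [coneMap_eq_iff, s.affineCombination_eq_linear_combination _ _ hw1]
      simp [Finset.sum_ite_mem, ite_mul, ← Finset.mul_sum, hw1, mul_assoc]
  · rintro ⟨c, hc, hx⟩
    rw [coneMap_eq_iff] at hx
    rw [Set.mem_smul_set_iff_inv_smul_mem₀ hk'.ne']
    refine mem_convexHull_of_exists_fintype (fun i => (k : ℝ)⁻¹ * c i)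
      (fun i => fun j => (v i j : ℝ)) (fun i => mul_nonneg (inv_nonneg.2 hk'.le) (hc i)) ?_
      (fun i => ⟨i, rfl⟩) ?_
    · rw [← Finset.mul_sum, hx.2, inv_mul_cancel₀ hk'.ne']
    · ext j
      simp [← hx.1 j, Finset.mul_sum, mul_assoc]

lemma ncard_lexReps {k : ℕ} (hk : 0 < k) :
    Set.ncard {x : Fin n → ℤ | (fun i => (x i : ℝ)) ∈
      (k : ℝ) • convexHull ℝ (Set.range fun i => fun j => (v i j : ℝ))} =
      (lexReps v k).ncard := by
  have hinj : Function.Injective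
      fun x : Fin n → ℤ => (((fun j => (x j : ℝ)), (k : ℝ)) : (Fin n → ℝ) × ℝ) := by
    intro x y h
    ext j
    have : (x j : ℝ) = y j := congrFun (congrArg Prod.fst h) j
    exact_mod_cast this
  rw [← Set.ncard_image_of_injective _ hinj, ← (injOn_coneMap_lexReps v k).ncard_image]
  congr 1
  ext y
  constructor
  · rintro ⟨x, hx, rfl⟩
    obtain ⟨c, hc, hcx⟩ := (mem_smul_convexHull_range_iff v hk _).1 hx
    obtain ⟨d, hd, hdc⟩ := exists_isLexMin_coneMap v hc
    exact ⟨d, ⟨hd, x, hdc.trans hcx⟩, hdc.trans hcx⟩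
  · rintro ⟨c, ⟨hc, x, hx⟩, rfl⟩
    exact ⟨x, (mem_smul_convexHull_range_iff v hk _).2 ⟨c, hc.1, hx⟩, hx.symm⟩

/-- Adding natural numbers on the support shifts the height of a representation. -/
lemma add_natCast_mem_lexReps_iff {b : Fin m → ℝ} {h k : ℕ} (hb : b ∈ lexReps v h)
    (f : Fin m → ℕ) (hf : ∀ i, b i = 0 → f i = 0) :
    (fun i => b i + f i) ∈ lexReps v k ↔ h + ∑ i, f i = k := by
  obtain ⟨hbmin, x, hx⟩ := hb
  have hmap : coneMap v (fun i => b i + f i) =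
      ((fun j => ((x j + ∑ i, (f i : ℤ) * v i j : ℤ) : ℝ)), ((h + ∑ i, f i : ℕ) : ℝ)) := by
    have : (fun i => b i + (f i : ℝ)) = b + fun i => (f i : ℝ) := rfl
    rw [this, map_add, hx, coneMap_natCast]
    ext <;> simp
  constructor
  · rintro ⟨-, y, hy⟩
    have : ((h + ∑ i, f i : ℕ) : ℝ) = k := congrArg Prod.snd (hmap.symm.trans hy)
    exact_mod_cast this
  · rintro rfl
    refine ⟨hbmin.of_support (fun i => add_nonneg (hbmin.1 i) (Nat.cast_nonneg _)) ?_, _, hmap⟩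
    intro i hi
    simp [hi, hf i hi]

end LexReps

/-- The integer part of a real number for which positive remainders lie in `(0, 1]`. -/
noncomputable def ceilPart (t : ℝ) : ℕ := ⌈t⌉₊ - 1

lemma ceilPart_le {t : ℝ} (ht : 0 ≤ t) : (ceilPart t : ℝ) ≤ t := by
  rcases ht.eq_or_lt with rfl | ht
  · simp [ceilPart]
  · have h1 : 1 ≤ ⌈t⌉₊ := Nat.one_le_ceil_iff.2 ht
    have h2 := Nat.ceil_lt_add_one ht.le
    rw [ceilPart, Nat.cast_sub h1, Nat.cast_one]
    linarith

lemma sub_ceilPart_le_one (t : ℝ) : t - ceilPart t ≤ 1 := by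
  have h1 := Nat.le_ceil t
  have h2 : (⌈t⌉₊ : ℝ) ≤ ceilPart t + 1 := by
    have : ⌈t⌉₊ ≤ ceilPart t + 1 := by unfold ceilPart; omega
    exact_mod_cast this
  linarith

lemma sub_ceilPart_eq_zero_iff {t : ℝ} (ht : 0 ≤ t) : t - ceilPart t = 0 ↔ t = 0 := by
  constructor
  · intro h
    by_contra hne
    have h1 : 1 ≤ ⌈t⌉₊ := Nat.one_le_ceil_iff.2 (ht.lt_of_ne' hne)
    have h2 : ⌈t⌉₊ = ceilPart t := by
      conv_lhs => rw [sub_eq_zero.1 h]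
      exact Nat.ceil_natCast _
    unfold ceilPart at h2
    omega
  · rintro rfl
    simp [ceilPart]

lemma ceilPart_add_natCast {t : ℝ} (h0 : 0 < t) (h1 : t ≤ 1) (a : ℕ) :
    ceilPart (t + a) = a := by
  have h2 : ⌈t⌉₊ = 1 := le_antisymm (Nat.ceil_le.2 (by simpa using h1)) (Nat.one_le_ceil_iff.2 h0)
  rw [ceilPart, Nat.ceil_add_natCast h0.le, h2]
  omega

/-- The remainders of a tuple in the half-open unit box. -/
noncomputable def boxPart {m : ℕ} (c : Fin m → ℝ) : Fin m → ℝ := fun i => c i - ceilPart (c i)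

section Counting

variable {m n : ℕ} (v : Fin m → Fin n → ℤ)

lemma boxPart_mem_lexReps {c : Fin m → ℝ} {k : ℕ} (hc : c ∈ lexReps v k) :
    ∃ h ≤ m, boxPart c ∈ lexReps v h := by
  obtain ⟨hmin, x, hx⟩ := hc
  have hnn : 0 ≤ boxPart c := fun i => sub_nonneg.2 (ceilPart_le (hmin.1 i))
  have hsum := ((coneMap_eq_iff v _ _ _).1 hx).2
  have hle : ∑ i, ceilPart (c i) ≤ k := by
    have : (∑ i, (ceilPart (c i) : ℝ)) ≤ k :=
      hsum ▸ Finset.sum_le_sum fun i _ => ceilPart_le (hmin.1 i)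
    exact_mod_cast this
  have hmap : coneMap v (boxPart c) =
      ((fun j => ((x j - ∑ i, (ceilPart (c i) : ℤ) * v i j : ℤ) : ℝ)),
        ((k - ∑ i, ceilPart (c i) : ℕ) : ℝ)) := by
    have : boxPart c = c - fun i => (ceilPart (c i) : ℝ) := rfl
    rw [this, map_sub, hx, coneMap_natCast, Nat.cast_sub hle]
    ext <;> simp
  refine ⟨_, ?_, hmin.of_support hnn fun i hi => (sub_ceilPart_eq_zero_iff (hmin.1 i)).2 hi,
    _, hmap⟩
  have h1 : ((k - ∑ i, ceilPart (c i) : ℕ) : ℝ) ≤ m := by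
    rw [← ((coneMap_eq_iff v _ _ _).1 hmap).2]
    calc ∑ i, boxPart c i ≤ ∑ _i : Fin m, (1 : ℝ) :=
          Finset.sum_le_sum fun i _ => sub_ceilPart_le_one _
      _ = m := by simp
  exact_mod_cast h1

lemma setOf_boxPart_eq {b : Fin m → ℝ} {h k : ℕ} (hb : b ∈ lexReps v h) (hb1 : b ≤ 1) :
    {c ∈ lexReps v k | boxPart c = b} =
      {c | ∃ f : Fin m → ℕ, (∀ i, b i = 0 → f i = 0) ∧ h + ∑ i, f i = k ∧
        (fun i => b i + f i) = c} := by
  ext c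
  constructor
  · rintro ⟨hc, rfl⟩
    have hcc : (fun i => boxPart c i + ceilPart (c i)) = c := by
      ext i; simp [boxPart]
    have hz : ∀ i, boxPart c i = 0 → ceilPart (c i) = 0 := by
      intro i hi
      have : c i = 0 := (sub_ceilPart_eq_zero_iff (hc.1.1 i)).1 hi
      simp [this, ceilPart]
    refine ⟨fun i => ceilPart (c i), hz, ?_, hcc⟩
    rw [← add_natCast_mem_lexReps_iff v hb _ hz, hcc]
    exact hc
  · rintro ⟨f, hf, hk, rfl⟩
    refine ⟨(add_natCast_mem_lexReps_iff v hb f hf).2 hk, ?_⟩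
    ext i
    rcases (hb.1.1 i).eq_or_lt with h0 | h0
    · have h0' : b i = 0 := h0.symm
      simp [boxPart, h0', hf i h0', ceilPart]
    · simp [boxPart, ceilPart_add_natCast h0 (hb1 i)]

lemma ncard_setOf_boxPart_eq {b : Fin m → ℝ} {h : ℕ} (hb : b ∈ lexReps v h) (hb1 : b ≤ 1)
    (a : ℕ) :
    Set.ncard {c ∈ lexReps v (h + a) | boxPart c = b} =
      (Finset.card {i | b i ≠ 0} + a - 1).choose a := by
  rw [setOf_boxPart_eq v hb hb1, ← Finset.card_finsuppAntidiag_nat_eq_choose,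
    ← Set.ncard_coe_finset]
  have hinj : Function.Injective fun (f : Fin m →₀ ℕ) (i : Fin m) => b i + (f i : ℝ) := by
    intro f g hfg
    ext i
    have := congrFun hfg i
    simpa using this
  rw [← Set.ncard_image_of_injective _ hinj]
  congr 1
  ext c
  constructor
  · rintro ⟨f, hf, hk, rfl⟩
    refine ⟨Finsupp.equivFunOnFinite.symm f, ?_, rfl⟩
    rw [Finset.mem_coe, Finset.mem_finsuppAntidiag]
    have hsub : ∀ i, i ∉ Finset.univ.filter (fun i => b i ≠ 0) → f i = 0 :=
      fun i hi => hf i (by simpa using hi)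
    refine ⟨?_, fun i hi => ?_⟩
    · exact (Finset.sum_subset (Finset.subset_univ _) fun i _ hi => hsub i hi).trans
        (Nat.add_left_cancel hk)
    · by_contra hn
      exact (Finsupp.mem_support_iff.1 hi) (hsub i hn)
  · rintro ⟨f, hf, rfl⟩
    rw [Finset.mem_coe, Finset.mem_finsuppAntidiag] at hf
    have hsub : ∀ i, i ∉ Finset.univ.filter (fun i => b i ≠ 0) → f i = 0 :=
      fun i hi => Finsupp.notMem_support_iff.1 fun h => hi (hf.2 h)
    refine ⟨f, fun i hi => hsub i (by simpa using hi), ?_, rfl⟩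
    rw [← hf.1, Finset.sum_subset (Finset.subset_univ _) fun i _ hi => hsub i hi]

lemma exists_polynomial_eval_eq_choose (a r : ℕ) :
    ∃ p : Polynomial ℚ, ∀ k : ℕ, 0 < k → p.eval (k : ℚ) = ((k + a - 1).choose r : ℚ) := by
  refine ⟨Polynomial.C ((r.factorial : ℚ)⁻¹) *
    (descPochhammer ℚ r).comp (Polynomial.X + Polynomial.C ((a : ℚ) - 1)), fun k hk => ?_⟩
  rw [Nat.cast_choose_eq_descPochhammer_div, Nat.cast_sub (by omega), Polynomial.eval_mul,
    Polynomial.eval_comp]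
  simp [div_eq_inv_mul, add_sub_assoc]

lemma exists_polynomial_ncard_boxPart_eq {b : Fin m → ℝ} {h : ℕ} (hb : b ∈ lexReps v h)
    (hb1 : b ≤ 1) :
    ∃ p : Polynomial ℚ, ∀ k : ℕ, 0 < k →
      p.eval (k : ℚ) = (Set.ncard {c ∈ lexReps v k | boxPart c = b} : ℚ) := by
  have hsum : ∑ i, b i = h := ((coneMap_eq_iff v _ _ _).1 hb.2.choose_spec).2
  set t := Finset.card {i | b i ≠ 0} with ht
  have hht : h ≤ t := by
    have : (h : ℝ) ≤ t := by
      rw [← hsum, ← Finset.sum_filter_ne_zero, ht, Finset.card_eq_sum_ones, Nat.cast_sum]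
      exact Finset.sum_le_sum fun i _ => by simpa using hb1 i
    exact_mod_cast this
  have hsmall : ∀ k < h, Set.ncard {c ∈ lexReps v k | boxPart c = b} = 0 := by
    intro k hk
    rw [setOf_boxPart_eq v hb hb1]
    convert Set.ncard_empty (Fin m → ℝ)
    ext c
    simp only [Set.mem_ofPred_eq, Set.mem_empty_iff_false, iff_false]
    rintro ⟨f, -, hk', -⟩
    omega
  rcases Nat.eq_zero_or_pos t with h0 | hpos
  · refine ⟨0, fun k hk => ?_⟩
    obtain rfl : h = 0 := by omega
    have := ncard_setOf_boxPart_eq v hb hb1 k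
    rw [← ht, h0, Nat.choose_eq_zero_of_lt (by omega)] at this
    rw [← zero_add k, this]
    simp
  · obtain ⟨p, hp⟩ := exists_polynomial_eval_eq_choose (t - h) (t - 1)
    refine ⟨p, fun k hk => ?_⟩
    rw [hp k hk]
    rcases lt_or_ge k h with hlt | hge
    · rw [hsmall k hlt, Nat.choose_eq_zero_of_lt (by omega)]
    · obtain ⟨a, rfl⟩ := Nat.exists_eq_add_of_le hge
      rw [ncard_setOf_boxPart_eq v hb hb1, ← ht, show h + a + (t - h) - 1 = t + a - 1 by omega]
      congr 1
      exact Nat.choose_symm_of_eq_add (by omega)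

lemma exists_polynomial_ncard_lexReps :
    ∃ p : Polynomial ℚ, ∀ k : ℕ, 0 < k → p.eval (k : ℚ) = ((lexReps v k).ncard : ℚ) := by
  classical
  have hfin : {b : Fin m → ℝ | b ≤ 1 ∧ ∃ h ≤ m, b ∈ lexReps v h}.Finite := by
    refine ((Set.finite_Iic m).biUnion fun h _ => finite_lexReps v h).subset ?_
    rintro b ⟨-, h, hm, hb⟩
    exact Set.mem_biUnion (Set.mem_Iic.2 hm) hb
  have hp : ∀ b : Fin m → ℝ, ∃ p : Polynomial ℚ, b ∈ hfin.toFinset → ∀ k : ℕ, 0 < k →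
      p.eval (k : ℚ) = (Set.ncard {c ∈ lexReps v k | boxPart c = b} : ℚ) := by
    intro b
    by_cases hb : b ∈ hfin.toFinset
    · obtain ⟨hb1, h, -, hb⟩ := hfin.mem_toFinset.1 hb
      obtain ⟨p, hp⟩ := exists_polynomial_ncard_boxPart_eq v hb hb1
      exact ⟨p, fun _ => hp⟩
    · exact ⟨0, fun h => absurd h hb⟩
  choose p hp using hp
  refine ⟨∑ b ∈ hfin.toFinset, p b, fun k hk => ?_⟩
  have hmaps : ∀ c ∈ (finite_lexReps v k).toFinset, boxPart c ∈ hfin.toFinset := by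
    intro c hc
    rw [Set.Finite.mem_toFinset] at hc ⊢
    exact ⟨fun i => sub_ceilPart_le_one _, boxPart_mem_lexReps v hc⟩
  rw [Polynomial.eval_finsetSum, Set.ncard_eq_toFinset_card _ (finite_lexReps v k),
    Finset.card_eq_sum_card_fiberwise hmaps, Nat.cast_sum]
  refine Finset.sum_congr rfl fun b hb => ?_
  rw [hp b hb k hk, ← Set.ncard_coe_finset]
  simp

end Counting

/-- Ehrhart's theorem for integral polytopes: the Ehrhart function of the convex hull
of a finite nonempty set of integer points is a polynomial. -/
theorem ehrhart_polynomial_of_integral_polytope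
    (n : ℕ) (S : Finset (Fin n → ℤ)) (hS : S.Nonempty) :
    ∃ p : Polynomial ℚ,
      ∀ k : ℕ, 0 < k →
        p.eval (k : ℚ) =
          (Set.ncard {x : Fin n → ℤ |
            (fun i => (x i : ℝ)) ∈
              (k : ℝ) • convexHull ℝ ((fun y : Fin n → ℤ => fun i => (y i : ℝ)) '' ↑S)} : ℚ) := by
  obtain ⟨p, hp⟩ := exists_polynomial_ncard_lexReps fun i => (S.equivFin.symm i : Fin n → ℤ)
  refine ⟨p, fun k hk => ?_⟩
  rw [hp k hk, ← ncard_lexReps _ hk]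
  have hrange : (fun y : Fin n → ℤ => fun i => (y i : ℝ)) '' ↑S =
      Set.range fun i => fun j => ((S.equivFin.symm i : Fin n → ℤ) j : ℝ) := by
    ext y
    constructor
    · rintro ⟨x, hx, rfl⟩
      exact ⟨S.equivFin ⟨x, hx⟩, by simp⟩
    · rintro ⟨i, rfl⟩
      exact ⟨_, (S.equivFin.symm i).2, rfl⟩
  rw [hrange]
end

section
/- Let S ⊆ ℚ^n be a finite nonempty set, let P = conv(S), and let ℓ be a positive integer such that ℓ·v ∈ ℤ^n for every v ∈ S. Then there exist polynomials p_0, …, p_{ℓ−1} with rational coefficients such that for every positive integer k, the number of points of ℤ^n in k·P equals p_r(k), where r = k mod ℓ. In other words, the Ehrhart function of a rational polytope is a quasipolynomial, and the least common multiple of the denominators of the vertex coordinates is a period. -/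
open scoped Pointwise

/-- `f` is a quasipolynomial on the positive integers, with period `ℓ`. -/
def IsQuasipolynomial (ℓ : ℕ) (f : ℕ → ℕ) : Prop :=
  ∃ p : ℕ → Polynomial ℚ, ∀ k : ℕ, 0 < k → (p (k % ℓ)).eval (k : ℚ) = (f k : ℚ)

namespace IsQuasipolynomial

theorem congr {ℓ : ℕ} {f g : ℕ → ℕ} (hf : IsQuasipolynomial ℓ f)
    (h : ∀ k, 0 < k → g k = f k) : IsQuasipolynomial ℓ g := by
  obtain ⟨p, hp⟩ := hf
  exact ⟨p, fun k hk => by rw [hp k hk, h k hk]⟩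

theorem zero (ℓ : ℕ) : IsQuasipolynomial ℓ fun _ => 0 :=
  ⟨fun _ => 0, fun k _ => by simp⟩

theorem sum {ℓ : ℕ} {α : Type*} (s : Finset α) {f : α → ℕ → ℕ}
    (hf : ∀ a ∈ s, IsQuasipolynomial ℓ (f a)) :
    IsQuasipolynomial ℓ fun k => ∑ a ∈ s, f a k := by
  choose! p hp using hf
  refine ⟨fun r => ∑ a ∈ s, p a r, fun k hk => ?_⟩
  rw [Polynomial.eval_finsetSum, Nat.cast_sum]
  exact Finset.sum_congr rfl fun a ha => hp a ha k hk

end IsQuasipolynomial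

theorem ncard_nat_compositions (κ : Type*) [Fintype κ] [Nonempty κ] (j : ℕ) :
    {m : κ → ℕ | ∑ i, m i = j}.ncard = (j + (Fintype.card κ - 1)).choose (Fintype.card κ - 1) := by
  classical
  have h : {m : κ → ℕ | ∑ i, m i = j} = ↑(Finset.piAntidiag (Finset.univ : Finset κ) j) := by
    ext m
    simp
  have hc : 0 < Fintype.card κ := Fintype.card_pos
  rw [h, Set.ncard_coe_finset, ← Finset.map_sym_eq_piAntidiag, Finset.card_map, Finset.sym_univ,
    Finset.card_univ, Sym.card_sym_eq_choose, ← Nat.choose_symm_add]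
  congr 1
  omega

theorem eval_preHilbertPoly_neg {d i : ℕ} (hi : 0 < i) (hid : i ≤ d) :
    (Polynomial.preHilbertPoly ℚ d 0).eval (-(i : ℚ)) = 0 := by
  have h : (-(i : ℚ)) + 1 = -((i - 1 : ℕ) : ℚ) := by
    rw [Nat.cast_sub hi]
    push_cast
    ring
  simpa [Polynomial.preHilbertPoly, h] using
    Or.inr (ascPochhammer_eval_neg_coe_nat_of_lt (R := ℚ) (by omega : i - 1 < d))

/-- The number of `m : κ → ℕ` with `ℓ * ∑ m + h = k`, as a function of `k`. -/
theorem isQuasipolynomial_ncard_compositions (κ : Type*) [Fintype κ] [Nonempty κ] {ℓ h : ℕ}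
    (hℓ : 0 < ℓ) (hh : h ≤ ℓ * Fintype.card κ) :
    IsQuasipolynomial ℓ fun k => {m : κ → ℕ | ℓ * ∑ i, m i + h = k}.ncard := by
  set d := Fintype.card κ with hd
  have hdpos : 0 < d := Fintype.card_pos
  have hℓ0 : (ℓ : ℚ) ≠ 0 := by positivity
  refine ⟨fun r => if r = h % ℓ then (Polynomial.preHilbertPoly ℚ (d - 1) 0).comp
    (Polynomial.C (ℓ : ℚ)⁻¹ * (Polynomial.X - Polynomial.C (h : ℚ))) else 0, fun k hk => ?_⟩
  dsimp only
  split_ifs with hr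
  · simp only [Polynomial.eval_comp, Polynomial.eval_mul, Polynomial.eval_C, Polynomial.eval_sub,
      Polynomial.eval_X]
    rcases le_or_gt h k with hhk | hhk
    · obtain ⟨j, hj⟩ := (Nat.modEq_iff_dvd' hhk).1 (show h % ℓ = k % ℓ from hr.symm)
      obtain rfl : k = ℓ * j + h := by omega
      have hset : {m : κ → ℕ | ℓ * ∑ i, m i + h = ℓ * j + h} = {m | ∑ i, m i = j} := by
        ext m
        simp [hℓ.ne']
      have harg : (ℓ : ℚ)⁻¹ * (((ℓ * j + h : ℕ) : ℚ) - h) = (j : ℚ) := by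
        push_cast
        field_simp
        ring
      rw [hset, ncard_nat_compositions, harg,
        Polynomial.preHilbertPoly_eq_choose_sub_add ℚ (d - 1) (Nat.zero_le j), Nat.sub_zero]
    · obtain ⟨i, hi⟩ := (Nat.modEq_iff_dvd' hhk.le).1 (show k % ℓ = h % ℓ from hr)
      obtain rfl : h = k + ℓ * i := by omega
      have hset : {m : κ → ℕ | ℓ * ∑ i, m i + (k + ℓ * i) = k} = ∅ := by
        ext m
        simp only [Set.mem_ofPred_eq, Set.mem_empty_iff_false, iff_false]
        omega
      have harg : (ℓ : ℚ)⁻¹ * ((k : ℚ) - ((k + ℓ * i : ℕ) : ℚ)) = -(i : ℚ) := by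
        push_cast
        field_simp
        ring
      have hi0 : 0 < i := Nat.pos_of_ne_zero (by rintro rfl; simp at hhk)
      have hid : i < d := lt_of_mul_lt_mul_left (by omega : ℓ * i < ℓ * d) hℓ.le
      rw [hset, harg, eval_preHilbertPoly_neg hi0 (by omega)]
      simp
  · have hset : {m : κ → ℕ | ℓ * ∑ i, m i + h = k} = ∅ := by
      ext m
      simp only [Set.mem_ofPred_eq, Set.mem_empty_iff_false, iff_false]
      rintro rfl
      simp at hr
    simp [hset]

theorem Set.Finite.ncard_eq_sum_ncard_fiber {α β : Type*} {E : Set α} (hE : E.Finite) {f : α → β}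
    {t : Finset β} (hf : ∀ a ∈ E, f a ∈ t) :
    E.ncard = ∑ b ∈ t, {a ∈ E | f a = b}.ncard := by
  classical
  lift E to Finset α using hE
  rw [Set.ncard_coe_finset, Finset.card_eq_sum_card_fiberwise hf]
  refine Finset.sum_congr rfl fun b _ => ?_
  rw [← Set.ncard_coe_finset]
  simp

/-- The lattice of integer points of `σ → ℝ`. -/
def integerLattice (σ : Type*) : AddSubgroup (σ → ℝ) :=
  ((Int.castAddHom ℝ).compLeft σ).range

theorem mem_integerLattice {σ : Type*} {y : σ → ℝ} :
    y ∈ integerLattice σ ↔ ∃ z : σ → ℤ, (fun s => (z s : ℝ)) = y :=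
  Iff.rfl

/-- The real linear combinations of the integer vectors `u j`. -/
noncomputable def realCombination {ι σ : Type*} [Fintype ι] (u : ι → σ → ℤ) :
    (ι → ℝ) →ₗ[ℝ] (σ → ℝ) :=
  Fintype.linearCombination ℝ fun j s => (u j s : ℝ)

section extendZero

variable {ι : Type*}

open Classical in
/-- Extension by zero of a vector indexed by `A`. -/
noncomputable def extendZero (A : Finset ι) (b : A → ℝ) (j : ι) : ℝ :=
  if h : j ∈ A then b ⟨j, h⟩ else 0

theorem extendZero_coe {A : Finset ι} (b : A → ℝ) (j : A) : extendZero A b j = b j := by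
  simp [extendZero]

theorem extendZero_of_notMem {A : Finset ι} (b : A → ℝ) {j : ι} (hj : j ∉ A) :
    extendZero A b j = 0 := by
  simp [extendZero, hj]

theorem extendZero_injective (A : Finset ι) : Function.Injective (extendZero A) := fun b b' h => by
  ext j
  rw [← extendZero_coe b, h, extendZero_coe]

end extendZero

section realCombination

variable {ι σ : Type*} [Fintype ι] (u : ι → σ → ℤ)

theorem realCombination_apply (a : ι → ℝ) (s : σ) :
    realCombination u a s = ∑ j, a j * (u j s : ℝ) := by
  simp [realCombination, Fintype.linearCombination_apply]

theorem realCombination_intCast_mem (m : ι → ℤ) :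
    realCombination u (fun j => (m j : ℝ)) ∈ integerLattice σ := by
  refine mem_integerLattice.2 ⟨fun s => ∑ j, m j * u j s, ?_⟩
  ext s
  simp [realCombination_apply]

variable {u}

theorem realCombination_height {ℓ : ℕ} {s₀ : σ} (hu : ∀ j, u j s₀ = ℓ) (a : ι → ℝ) :
    realCombination u a s₀ = ℓ * ∑ j, a j := by
  simp [realCombination_apply, hu, ← Finset.sum_mul, mul_comm]

theorem le_of_height_eq {ℓ : ℕ} (hℓ : 0 < ℓ) {s₀ : σ} (hu : ∀ j, u j s₀ = ℓ) {a : ι → ℝ}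
    (ha : ∀ j, 0 ≤ a j) {c : ℝ} (hc : realCombination u a s₀ = c) (j : ι) : a j ≤ c := by
  have h1 : a j ≤ ∑ j, a j := Finset.single_le_sum (fun i _ => ha i) (Finset.mem_univ j)
  have h2 : (1 : ℝ) ≤ ℓ := by exact_mod_cast hℓ
  rw [realCombination_height hu] at hc
  nlinarith [ha j]

theorem finite_of_realCombination_mem [Finite σ] {E : Set (ι → ℝ)} {c : ℝ}
    (hinj : Set.InjOn (realCombination u) E) (hE : ∀ a ∈ E, ∀ j, 0 ≤ a j ∧ a j ≤ c)
    (hmem : ∀ a ∈ E, realCombination u a ∈ integerLattice σ) : E.Finite := by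
  have := Fintype.ofFinite σ
  classical
  refine Set.Finite.of_finite_image ?_ hinj
  let M : σ → ℤ := fun s => ⌈∑ j, c * |(u j s : ℝ)|⌉
  refine ((Set.finite_Icc (-M) M).image fun z s => (z s : ℝ)).subset ?_
  rintro _ ⟨a, ha, rfl⟩
  obtain ⟨z, hz⟩ := mem_integerLattice.1 (hmem a ha)
  have hb : ∀ s, |z s| ≤ M s := fun s => by
    have h1 : |(z s : ℝ)| ≤ ∑ j, c * |(u j s : ℝ)| := by
      rw [congrFun hz s, realCombination_apply]
      refine (Finset.abs_sum_le_sum_abs _ _).trans (Finset.sum_le_sum fun j _ => ?_)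
      rw [abs_mul, abs_of_nonneg (hE a ha j).1]
      exact mul_le_mul_of_nonneg_right (hE a ha j).2 (abs_nonneg _)
    exact Int.cast_le.1 (by simpa using h1.trans (Int.le_ceil _) : ((|z s| : ℤ) : ℝ) ≤ M s)
  exact ⟨z, ⟨fun s => (abs_le.1 (hb s)).1, fun s => (abs_le.1 (hb s)).2⟩, hz⟩

/-- The lattice points in the dilates of a relatively open simplex. -/
theorem isQuasipolynomial_ncard_openSimplex [Finite σ] [Nonempty ι] {ℓ : ℕ} (hℓ : 0 < ℓ) {s₀ : σ}
    (hu : ∀ j, u j s₀ = ℓ) (hinj : Function.Injective (realCombination u)) :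
    IsQuasipolynomial ℓ fun k => {a : ι → ℝ | (∀ j, 0 < a j) ∧
      realCombination u a ∈ integerLattice σ ∧ realCombination u a s₀ = k}.ncard := by
  set E : ℕ → Set (ι → ℝ) := fun k => {a | (∀ j, 0 < a j) ∧
      realCombination u a ∈ integerLattice σ ∧ realCombination u a s₀ = k} with hEdef
  let B : Set (ι → ℝ) := {b | (∀ j, 0 < b j ∧ b j ≤ 1) ∧ realCombination u b ∈ integerLattice σ}
  let f : (ι → ℝ) → ι → ℝ := fun a j => a j - ((⌈a j⌉ - 1 : ℤ) : ℝ)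
  have hB : B.Finite := finite_of_realCombination_mem (c := 1) hinj.injOn
    (fun a ha j => ⟨(ha.1 j).1.le, (ha.1 j).2⟩) fun a ha => ha.2
  have hE : ∀ k, (E k).Finite := fun k => finite_of_realCombination_mem (c := k) hinj.injOn
    (fun a ha j => ⟨(ha.1 j).le, le_of_height_eq hℓ hu (fun i => (ha.1 i).le) ha.2.2 j⟩)
    fun a ha => ha.2.1
  have hf : ∀ k, ∀ a ∈ E k, f a ∈ hB.toFinset := fun k a ha => by
    refine hB.mem_toFinset.2 ⟨fun j => ?_, ?_⟩
    · have h1 := Int.le_ceil (a j)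
      have h2 := Int.ceil_lt_add_one (a j)
      simp only [f]
      push_cast
      constructor <;> linarith
    · have : f a = a - fun j => ((⌈a j⌉ - 1 : ℤ) : ℝ) := rfl
      rw [this, map_sub]
      exact sub_mem ha.2.1 (realCombination_intCast_mem u _)
  refine IsQuasipolynomial.congr (IsQuasipolynomial.sum hB.toFinset
    (f := fun b k => {a ∈ E k | f a = b}.ncard) fun b hb => ?_)
    fun k _ => (hE k).ncard_eq_sum_ncard_fiber (hf k)
  obtain ⟨hb, hbL⟩ := hB.mem_toFinset.1 hb
  obtain ⟨z, hz⟩ := mem_integerLattice.1 hbL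
  have hz0 : (z s₀ : ℝ) = ℓ * ∑ j, b j := by
    rw [← realCombination_height hu, ← hz]
  have hznn : 0 ≤ z s₀ := by
    have : (0 : ℝ) ≤ z s₀ := by
      rw [hz0]
      exact mul_nonneg (Nat.cast_nonneg _) (Finset.sum_nonneg fun j _ => (hb j).1.le)
    exact_mod_cast this
  obtain ⟨h, hh⟩ := Int.eq_ofNat_of_zero_le hznn
  rw [hh, Int.cast_natCast] at hz0
  have hle : h ≤ ℓ * Fintype.card ι := by
    have : (h : ℝ) ≤ ℓ * Fintype.card ι := by
      rw [hz0]
      refine mul_le_mul_of_nonneg_left ?_ (Nat.cast_nonneg _)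
      refine (Finset.sum_le_sum fun j _ => (hb j).2).trans ?_
      simp
    exact_mod_cast this
  refine (isQuasipolynomial_ncard_compositions ι hℓ hle).congr fun k _ => ?_
  let g : (ι → ℕ) → ι → ℝ := fun m j => b j + m j
  have hg : Function.Injective g := fun m m' hm => by
    ext j
    simpa [g] using congrFun hm j
  have hheight : ∀ m, realCombination u (g m) s₀ = ((ℓ * ∑ j, m j + h : ℕ) : ℝ) := fun m => by
    rw [realCombination_height hu]
    push_cast
    rw [hz0, Finset.sum_add_distrib]
    ring
  rw [← Set.ncard_image_of_injective _ hg]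
  congr 1
  ext a
  constructor
  · rintro ⟨⟨hpos, -, hk⟩, rfl⟩
    have ha : g (fun j => (⌈a j⌉ - 1).toNat) = a := by
      ext j
      have h1 : 0 ≤ ⌈a j⌉ - 1 := by
        have := Int.ceil_pos.2 (hpos j)
        omega
      have h2 : (((⌈a j⌉ - 1).toNat : ℕ) : ℝ) = ((⌈a j⌉ - 1 : ℤ) : ℝ) := by
        exact_mod_cast Int.toNat_of_nonneg h1
      simp only [g, f, h2]
      ring
    refine ⟨_, ?_, ha⟩
    have := hheight fun j => (⌈a j⌉ - 1).toNat
    rw [ha, hk] at this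
    exact (by exact_mod_cast this.symm)
  · rintro ⟨m, hm, rfl⟩
    refine ⟨⟨fun j => add_pos_of_pos_of_nonneg (hb j).1 (Nat.cast_nonneg _), ?_, ?_⟩, ?_⟩
    · have : g m = b + fun j => ((m j : ℤ) : ℝ) := by
        ext j
        simp [g]
      rw [this, map_add]
      exact add_mem hbL (realCombination_intCast_mem u _)
    · rw [hheight, hm]
    · ext j
      have h1 : ⌈b j + m j⌉ = m j + 1 := by
        rw [Int.ceil_eq_iff]
        push_cast
        constructor <;> linarith [(hb j).1, (hb j).2]
      simp [f, g, h1]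

theorem IsCompact.exists_toLex_le [LinearOrder ι] {K : Set (ι → ℝ)} (hK : IsCompact K)
    (hne : K.Nonempty) : ∃ a ∈ K, ∀ b ∈ K, toLex a ≤ toLex b := by
  classical
  have key : ∀ t : Finset ι, ∃ a ∈ K, ∀ b ∈ K, (∀ i ∈ t, a i = b i) ∨
      ∃ i ∈ t, (∀ j ∈ t, j < i → a j = b j) ∧ a i < b i := by
    intro t
    induction t using Finset.induction_on_max with
    | empty =>
      obtain ⟨a, ha⟩ := hne
      exact ⟨a, ha, fun b _ => Or.inl (by simp)⟩
    | insert m t hm ih =>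
      obtain ⟨a, ha, hmin⟩ := ih
      have hcl : IsClosed {b : ι → ℝ | ∀ i ∈ t, a i = b i} := by
        simp only [Set.ofPred_forall]
        exact isClosed_biInter fun i _ => isClosed_eq continuous_const (continuous_apply i)
      obtain ⟨c, ⟨hcK, hca⟩, hc⟩ := (hK.inter_right hcl).exists_isMinOn
        ⟨a, ha, fun i _ => rfl⟩ (continuous_apply m).continuousOn
      have hca' : ∀ i ∈ t, a i = c i := hca
      refine ⟨c, hcK, fun b hb => ?_⟩
      rcases hmin b hb with h | ⟨i, hi, hlt, hab⟩
      · have hcb : c m ≤ b m := hc ⟨hb, h⟩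
        have hcb' : ∀ i ∈ t, c i = b i := fun i hi => (hca' i hi).symm.trans (h i hi)
        rcases hcb.eq_or_lt with he | hl
        · refine Or.inl fun i hi => ?_
          rcases Finset.mem_insert.1 hi with rfl | hi
          exacts [he, hcb' i hi]
        · refine Or.inr ⟨m, Finset.mem_insert_self _ _, fun j hj hjm => ?_, hl⟩
          exact hcb' j ((Finset.mem_insert.1 hj).resolve_left hjm.ne)
      · refine Or.inr ⟨i, Finset.mem_insert_of_mem hi, fun j hj hji => ?_, hca' i hi ▸ hab⟩
        have hjt : j ∈ t := (Finset.mem_insert.1 hj).resolve_left (hji.trans (hm i hi)).ne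
        exact (hca' j hjt).symm.trans (hlt j hjt hji)
  obtain ⟨a, ha, hmin⟩ := key Finset.univ
  refine ⟨a, ha, fun b hb => ?_⟩
  rcases hmin b hb with h | ⟨i, -, hlt, hab⟩
  · exact (congrArg toLex (funext fun i => h i (Finset.mem_univ i))).le
  · exact le_of_lt ⟨i, fun j hj => hlt j (Finset.mem_univ j) hj, hab⟩

/-- The nonnegative vectors with support `A` are lexicographically minimal among the nonnegative
vectors with the same real combination of the `u j`. -/
def IsLexMinSupport [LinearOrder ι] (u : ι → σ → ℤ) (A : Set ι) : Prop :=
  ∀ μ : ι → ℝ, realCombination u μ = 0 → (∀ j ∉ A, 0 ≤ μ j) → 0 ≤ toLex μ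

theorem IsLexMinSupport.eq_of_realCombination_eq [LinearOrder ι] {a b : ι → ℝ} {A B : Set ι}
    (hA : IsLexMinSupport u A) (hB : IsLexMinSupport u B)
    (hab : ∀ j ∉ A, a j ≤ b j) (hba : ∀ j ∉ B, b j ≤ a j)
    (h : realCombination u a = realCombination u b) : a = b := by
  have h1 := hA (b - a) (by rw [map_sub, h, sub_self]) fun j hj => sub_nonneg.2 (hab j hj)
  have h2 := hB (a - b) (by rw [map_sub, h, sub_self]) fun j hj => sub_nonneg.2 (hba j hj)
  rw [toLex_sub, sub_nonneg] at h1 h2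
  exact toLex_inj.1 (le_antisymm h1 h2)

theorem exists_isLexMinSupport [LinearOrder ι] {ℓ : ℕ} (hℓ : 0 < ℓ) {s₀ : σ}
    (hu : ∀ j, u j s₀ = ℓ) {a : ι → ℝ} (ha : ∀ j, 0 ≤ a j) :
    ∃ b : ι → ℝ, (∀ j, 0 ≤ b j) ∧ realCombination u b = realCombination u a ∧
      IsLexMinSupport u (Function.support b) := by
  let K : Set (ι → ℝ) := {b | (∀ j, 0 ≤ b j) ∧ realCombination u b = realCombination u a}
  have hcont : Continuous (realCombination u) := continuous_pi fun s => by
    simp only [realCombination_apply]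
    fun_prop
  have hnonneg : IsClosed {b : ι → ℝ | ∀ j, 0 ≤ b j} := by
    simp only [Set.ofPred_forall]
    exact isClosed_iInter fun i => isClosed_le continuous_const (continuous_apply i)
  have hcl : IsClosed K := hnonneg.inter (isClosed_eq hcont continuous_const)
  have hK : IsCompact K := by
    refine (isCompact_Icc (a := (0 : ι → ℝ)) (b := fun _ => realCombination u a s₀)).of_isClosed_subset
      hcl fun b hb => ⟨hb.1, fun j => le_of_height_eq hℓ hu hb.1 (congrFun hb.2 s₀) j⟩
  obtain ⟨b, hb, hmin⟩ := hK.exists_toLex_le ⟨a, ha, rfl⟩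
  refine ⟨b, hb.1, hb.2, fun μ hμ hnn => ?_⟩
  have hev : ∀ᶠ ε : ℝ in nhdsWithin 0 (Set.Ioi 0), ∀ j, 0 ≤ b j + ε * μ j := by
    refine Filter.eventually_all.2 fun j => ?_
    by_cases hj : b j = 0
    · filter_upwards [self_mem_nhdsWithin] with ε hε
      rw [hj, zero_add]
      exact mul_nonneg (le_of_lt hε) (hnn j (by simpa using hj))
    · have hpos : 0 < b j := lt_of_le_of_ne (hb.1 j) (Ne.symm hj)
      have ht : Filter.Tendsto (fun ε : ℝ => b j + ε * μ j) (nhds 0) (nhds (b j)) := by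
        have : Continuous fun ε : ℝ => b j + ε * μ j := by fun_prop
        simpa using this.tendsto 0
      exact ((ht.eventually (lt_mem_nhds hpos)).filter_mono nhdsWithin_le_nhds).mono
        fun _ h => le_of_lt h
  obtain ⟨ε, hε, hεpos⟩ := (hev.and self_mem_nhdsWithin).exists
  have hεpos' : 0 < ε := hεpos
  have hle : toLex b ≤ toLex (b + ε • μ) := hmin _ ⟨hε, by simp [hμ, hb.2]⟩
  rw [toLex_add, le_add_iff_nonneg_right] at hle
  by_contra hneg
  obtain ⟨i, hi, hlt⟩ := not_le.1 hneg
  refine not_lt_of_ge hle ⟨i, fun j hj => ?_, ?_⟩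
  · have h0 : μ j = 0 := hi j hj
    exact (by simp [h0] : ε * μ j = 0)
  · have h0 : μ i < 0 := hlt
    exact (mul_neg_of_pos_of_neg hεpos' h0 : ε * μ i < 0)

theorem realCombination_extendZero {A : Finset ι} (b : A → ℝ) :
    realCombination u (extendZero A b) = realCombination (fun j : A => u j) b := by
  ext s
  rw [realCombination_apply, realCombination_apply, ← Finset.sum_subset A.subset_univ,
    ← Finset.sum_coe_sort]
  · exact Finset.sum_congr rfl fun j _ => by rw [extendZero_coe]
  · intro j _ hj
    rw [extendZero_of_notMem b hj, zero_mul]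

theorem ncard_eq_ncard_of_support_eq (A : Finset ι) (P : (σ → ℝ) → Prop) :
    {a : ι → ℝ | (∀ j, 0 ≤ a j) ∧ Function.support a = A ∧ P (realCombination u a)}.ncard =
      {a : A → ℝ | (∀ j, 0 < a j) ∧ P (realCombination (fun j : A => u j) a)}.ncard := by
  rw [← Set.ncard_image_of_injective _ (extendZero_injective A)]
  congr 1
  ext a
  constructor
  · rintro ⟨hnn, hs, hP⟩
    have ha : extendZero A (fun j => a j) = a := by
      ext j
      by_cases hj : j ∈ A
      · exact extendZero_coe (fun j : A => a j) ⟨j, hj⟩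
      · rw [extendZero_of_notMem _ hj, eq_comm, ← Function.notMem_support, hs]
        exact hj
    refine ⟨fun j => a j, ⟨fun j => lt_of_le_of_ne (hnn j) (Ne.symm ?_), ?_⟩, ha⟩
    · rw [← Function.mem_support, hs]
      exact j.2
    · rwa [← realCombination_extendZero, ha]
  · rintro ⟨b, ⟨hpos, hP⟩, rfl⟩
    have hmem : ∀ j (hj : j ∈ A), 0 < extendZero A b j := fun j hj =>
      (hpos ⟨j, hj⟩).trans_eq (extendZero_coe b ⟨j, hj⟩).symm
    refine ⟨fun j => ?_, ?_, by rwa [realCombination_extendZero]⟩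
    · by_cases hj : j ∈ A
      · exact (hmem j hj).le
      · exact (extendZero_of_notMem b hj).ge
    · ext j
      by_cases hj : j ∈ A
      · simp [hj, (hmem j hj).ne']
      · simp [hj, extendZero_of_notMem b hj]

theorem IsLexMinSupport.injective_realCombination [LinearOrder ι] {A : Finset ι}
    (hA : IsLexMinSupport u (A : Set ι)) :
    Function.Injective (realCombination fun j : A => u j) := fun b b' h => by
  have h0 : ∀ (c : A → ℝ), ∀ j ∉ (A : Set ι), extendZero A c j = 0 := fun c j hj =>
    extendZero_of_notMem c hj
  refine extendZero_injective A (hA.eq_of_realCombination_eq hA (fun j hj => ?_) (fun j hj => ?_) ?_)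
  · rw [h0 b j hj, h0 b' j hj]
  · rw [h0 b j hj, h0 b' j hj]
  · rw [realCombination_extendZero, realCombination_extendZero, h]

/-- The lattice points of height `k` in the cone generated by the vectors `u j`, all of height
`ℓ`. -/
theorem isQuasipolynomial_ncard_cone [Finite σ] {ℓ : ℕ} (hℓ : 0 < ℓ) {s₀ : σ}
    (hu : ∀ j, u j s₀ = ℓ) :
    IsQuasipolynomial ℓ fun k => {z : σ → ℤ | z s₀ = k ∧
      ∃ a : ι → ℝ, (∀ j, 0 ≤ a j) ∧ realCombination u a = fun s => (z s : ℝ)}.ncard := by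
  classical
  let : LinearOrder ι := linearOrderOfSTO WellOrderingRel
  let P : ℕ → (σ → ℝ) → Prop := fun k y => y ∈ integerLattice σ ∧ y s₀ = k
  let E : ℕ → Set (ι → ℝ) := fun k => {a | (∀ j, 0 ≤ a j) ∧
    IsLexMinSupport u (Function.support a) ∧ P k (realCombination u a)}
  have hinj : ∀ k, Set.InjOn (realCombination u) (E k) := fun k a ha b hb h => by
    refine ha.2.1.eq_of_realCombination_eq hb.2.1 (fun j hj => ?_) (fun j hj => ?_) h
    · rw [Function.notMem_support.1 hj]
      exact hb.1 j
    · rw [Function.notMem_support.1 hj]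
      exact ha.1 j
  have hfin : ∀ k, (E k).Finite := fun k => finite_of_realCombination_mem (c := k) (hinj k)
    (fun a ha j => ⟨ha.1 j, le_of_height_eq hℓ hu ha.1 ha.2.2.2 j⟩) fun a ha => ha.2.2.1
  have hcast : Function.Injective fun (z : σ → ℤ) s => (z s : ℝ) := fun z z' h => by
    ext s
    exact Int.cast_injective (congrFun h s)
  have hcard : ∀ k : ℕ, {z : σ → ℤ | z s₀ = k ∧ ∃ a : ι → ℝ, (∀ j, 0 ≤ a j) ∧
      realCombination u a = fun s => (z s : ℝ)}.ncard = (E k).ncard := fun k => by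
    rw [← (hinj k).ncard_image, ← Set.ncard_image_of_injective _ hcast]
    congr 1
    ext y
    constructor
    · rintro ⟨z, ⟨hz, a, ha, haz⟩, rfl⟩
      obtain ⟨b, hb, hba, hmin⟩ := exists_isLexMinSupport hℓ hu ha
      refine ⟨b, ⟨hb, hmin, ?_⟩, hba.trans haz⟩
      rw [hba, haz]
      exact ⟨⟨z, rfl⟩, by simp [hz]⟩
    · rintro ⟨a, ⟨ha, -, ⟨z, hz⟩, hk⟩, rfl⟩
      refine ⟨z, ⟨?_, a, ha, hz.symm⟩, hz⟩
      have hk' : (z s₀ : ℝ) = k := (congrFun hz s₀).trans hk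
      exact_mod_cast hk'
  refine IsQuasipolynomial.congr (IsQuasipolynomial.sum Finset.univ
    (f := fun (A : Finset ι) k => {a ∈ E k | (Function.support a).toFinset = A}.ncard)
    fun A _ => ?_) fun k _ => (hcard k).trans
      ((hfin k).ncard_eq_sum_ncard_fiber fun a _ => Finset.mem_univ _)
  by_cases hA : IsLexMinSupport u (A : Set ι)
  · have heq : ∀ k, {a ∈ E k | (Function.support a).toFinset = A} =
        {a | (∀ j, 0 ≤ a j) ∧ Function.support a = A ∧ P k (realCombination u a)} := fun k => by
      ext a
      have hs : (Function.support a).toFinset = A ↔ Function.support a = A := by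
        rw [← Finset.coe_inj, Set.coe_toFinset]
      constructor
      · rintro ⟨⟨h1, -, h3⟩, h4⟩
        exact ⟨h1, hs.1 h4, h3⟩
      · rintro ⟨h1, h2, h3⟩
        exact ⟨⟨h1, h2 ▸ hA, h3⟩, hs.2 h2⟩
    simp only [heq, ncard_eq_ncard_of_support_eq]
    rcases A.eq_empty_or_nonempty with rfl | hne
    · refine (IsQuasipolynomial.zero ℓ).congr fun k hk => ?_
      rw [Set.eq_empty_of_forall_notMem (s := {a | _}), Set.ncard_empty]
      rintro a ⟨-, -, ha⟩
      have h0 : (0 : ℝ) = k := by simpa [realCombination_apply] using ha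
      exact hk.ne (by exact_mod_cast h0)
    · have := hne.to_subtype
      exact isQuasipolynomial_ncard_openSimplex hℓ (fun j : A => hu j) hA.injective_realCombination
  · refine (IsQuasipolynomial.zero ℓ).congr fun k _ => ?_
    have : {a ∈ E k | (Function.support a).toFinset = A} = ∅ := by
      refine Set.eq_empty_of_forall_notMem ?_
      rintro a ⟨⟨-, h, -⟩, rfl⟩
      exact hA (by rwa [Set.coe_toFinset])
    rw [this, Set.ncard_empty]

end realCombination

theorem mem_smul_convexHull_iff {E F : Type*} [AddCommGroup F] [Module ℝ F] (S : Finset E)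
    {f : E → F} (hf : Function.Injective f) {k : ℝ} (hk : 0 < k) {x : F} :
    x ∈ k • convexHull ℝ (f '' (S : Set E)) ↔
      ∃ a : S → ℝ, (∀ v, 0 ≤ a v) ∧ ∑ v, a v = k ∧ ∑ v, a v • f v = x := by
  classical
  rw [Set.mem_smul_set_iff_inv_smul_mem₀ hk.ne', ← Finset.coe_image, Finset.mem_convexHull']
  simp only [Finset.sum_image hf.injOn, Finset.forall_mem_image, ← Finset.sum_coe_sort S]
  constructor
  · rintro ⟨w, hw, h1, hx⟩
    refine ⟨fun v => k * w (f v), fun v => mul_nonneg hk.le (hw v.2), ?_, ?_⟩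
    · rw [← Finset.mul_sum, h1, mul_one]
    · simp only [mul_smul]
      rw [← Finset.smul_sum, hx, smul_inv_smul₀ hk.ne']
  · rintro ⟨a, ha, h1, hx⟩
    have hw : ∀ v : S, Function.extend (fun v : S => f v) (fun v => k⁻¹ * a v) 0 (f v) = k⁻¹ * a v :=
      fun v => (hf.comp Subtype.val_injective).extend_apply _ _ v
    refine ⟨Function.extend (fun v : S => f v) (fun v => k⁻¹ * a v) 0, fun v hv => ?_, ?_, ?_⟩
    · rw [hw ⟨v, hv⟩]
      exact mul_nonneg (inv_nonneg.2 hk.le) (ha _)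
    · simp only [hw]
      rw [← Finset.mul_sum, h1, inv_mul_cancel₀ hk.ne']
    · simp only [hw, mul_smul]
      rw [← Finset.smul_sum, hx]

/-- Ehrhart's theorem for rational polytopes: the Ehrhart function of the convex hull of a
finite nonempty set of rational points is a quasipolynomial, and any common denominator `ℓ`
of the coordinates of the points is a period. -/
theorem ehrhart_quasipolynomial_of_rational_polytope
    (n : ℕ) (S : Finset (Fin n → ℚ)) (hS : S.Nonempty) (ℓ : ℕ) (hℓ : 0 < ℓ)
    (hden : ∀ v ∈ S, ∀ i, ∃ z : ℤ, (ℓ : ℚ) * v i = (z : ℚ)) :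
    ∃ p : ℕ → Polynomial ℚ,
      ∀ k : ℕ, 0 < k →
        (p (k % ℓ)).eval (k : ℚ) =
          (Set.ncard {x : Fin n → ℤ |
            (fun i => (x i : ℝ)) ∈
              (k : ℝ) • convexHull ℝ ((fun y : Fin n → ℚ => fun i => (y i : ℝ)) '' ↑S)} : ℚ) := by
  choose! z hz using hden
  let u : S → Option (Fin n) → ℤ := fun v s => s.elim (ℓ : ℤ) (z v)
  have hℓ0 : (ℓ : ℝ) ≠ 0 := by positivity
  have hu0 : ∀ v, u v none = ℓ := fun _ => rfl
  have hu : ∀ (v : S) i, (u v (some i) : ℝ) = ℓ * ((v : Fin n → ℚ) i : ℝ) := fun v i => by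
    have h := hz v v.2 i
    exact_mod_cast (congrArg (Rat.cast : ℚ → ℝ) h).symm
  have hcast : Function.Injective fun (y : Fin n → ℚ) i => (y i : ℝ) := fun y y' h => by
    ext i
    exact Rat.cast_injective (congrFun h i)
  refine (isQuasipolynomial_ncard_cone (u := u) (s₀ := none) hℓ hu0).congr fun k hk => ?_
  have hk' : (0 : ℝ) < k := by exact_mod_cast hk
  let g : (Fin n → ℤ) → Option (Fin n) → ℤ := fun x s => s.elim (k : ℤ) x
  have hg : Function.Injective g := fun x x' h => funext fun i => congrFun h (some i)
  have hiff : ∀ x : Fin n → ℤ, (fun i => (x i : ℝ)) ∈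
      (k : ℝ) • convexHull ℝ ((fun y : Fin n → ℚ => fun i => (y i : ℝ)) '' (S : Set _)) ↔
      ∃ a : S → ℝ, (∀ j, 0 ≤ a j) ∧ realCombination u a = fun s => (g x s : ℝ) := fun x => by
    rw [mem_smul_convexHull_iff S hcast hk']
    constructor
    · rintro ⟨a, ha, hsum, hx⟩
      refine ⟨fun v => (ℓ : ℝ)⁻¹ * a v, fun v => mul_nonneg (by positivity) (ha v), ?_⟩
      ext (_ | i)
      · rw [realCombination_height hu0, ← Finset.mul_sum, hsum,
          mul_inv_cancel_left₀ hℓ0]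
        simp [g]
      · have hxi := congrFun hx i
        simp only [Finset.sum_apply, Pi.smul_apply, smul_eq_mul] at hxi
        rw [realCombination_apply]
        refine Eq.trans (Finset.sum_congr rfl fun v _ => ?_) hxi
        rw [hu]
        field_simp
    · rintro ⟨a, ha, hax⟩
      refine ⟨fun v => ℓ * a v, fun v => mul_nonneg (by positivity) (ha v), ?_, ?_⟩
      · have h := congrFun hax none
        rw [realCombination_height hu0] at h
        rw [← Finset.mul_sum, h]
        simp [g]
      · ext i
        refine Eq.trans ?_ (congrFun hax (some i))
        rw [realCombination_apply, Finset.sum_apply]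
        refine Finset.sum_congr rfl fun v _ => ?_
        rw [hu, Pi.smul_apply, smul_eq_mul]
        ring
  rw [← Set.ncard_image_of_injective _ hg]
  congr 1
  ext y
  constructor
  · rintro ⟨x, hx, rfl⟩
    exact ⟨rfl, (hiff x).1 hx⟩
  · rintro ⟨hy, hex⟩
    have hgy : g (fun i => y (some i)) = y := by
      ext (_ | i)
      exacts [hy.symm, rfl]
    exact ⟨_, (hiff _).2 (by rwa [hgy]), hgy⟩
end

section
/- (Ehrhart–Macdonald reciprocity) Let S ⊆ ℤ^n be a finite nonempty set, let P = conv(S), let d be the dimension of the affine hull of P, and let p be the polynomial with rational coefficients satisfying p(k) = #(ℤ^n ∩ k·P) for all positive integers k. Then for every positive integer k, p(−k) = (−1)^d · #(ℤ^n ∩ k·P°), where P° is the relative interior of P (the interior of P taken with respect to its affine hull). -/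
open scoped Pointwise

open Module Polynomial

section HalfOpenSimplicialCones

/-- The number of `κ`-tuples of natural numbers with sum `k - g`, in a form that stays valid
when `k < g` as long as the excess is smaller than the number of entries. -/
theorem ncard_nat_tuples_sum_add_eq {κ : Type*} [Fintype κ] (r g k : ℕ)
    (hr : Fintype.card κ = r + 1) (hg : g ≤ k + r) :
    {m : κ → ℕ | ∑ i, m i + g = k}.ncard = (k + r - g).choose r := by
  classical
  by_cases hk : g ≤ k
  · have h1 : {m : κ → ℕ | ∑ i, m i + g = k} = {m : κ → ℕ | ∑ i, m i = k - g} := by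
      ext m; simp only [Set.mem_ofPred_eq]; omega
    rw [h1]
    have h2 := Nat.card_congr (Sym.equivNatSumOfFintype κ (k - g))
    rw [Nat.card_eq_fintype_card, Sym.card_sym_eq_choose, hr] at h2
    rw [← Nat.card_coe_set_eq]
    refine h2.symm.trans ?_
    have h3 : r + 1 + (k - g) - 1 = k + r - g := by omega
    rw [h3, ← Nat.choose_symm_of_eq_add (n := k + r - g) (a := k - g) (b := r) (by omega)]
  · have h1 : {m : κ → ℕ | ∑ i, m i + g = k} = ∅ :=
      Set.eq_empty_of_forall_notMem fun m hm => by
        have : ∑ i, m i + g = k := hm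
        omega
    rw [h1, Set.ncard_empty, Nat.choose_eq_zero_of_lt (by omega)]

/-- The polynomial `X ↦ binom (X + r - g) r`. -/
noncomputable def shiftedChoose (r g : ℕ) : ℚ[X] :=
  C ((r.factorial : ℚ)⁻¹) * (descPochhammer ℚ r).comp (X + C ((r : ℚ) - g))

theorem shiftedChoose_eval (r g k : ℕ) (hg : g ≤ k + r) :
    (shiftedChoose r g).eval (k : ℚ) = ((k + r - g).choose r : ℕ) := by
  have h1 : (k : ℚ) + (r - g) = ((k + r - g : ℕ) : ℚ) := by
    rw [Nat.cast_sub hg]; push_cast; ring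
  simp only [shiftedChoose, eval_mul, eval_C, eval_comp, eval_add, eval_X]
  rw [h1, descPochhammer_eval_eq_descFactorial, Nat.descFactorial_eq_factorial_mul_choose]
  push_cast
  have : (r.factorial : ℚ) ≠ 0 := by exact_mod_cast r.factorial_ne_zero
  field_simp

theorem shiftedChoose_eval_neg (r g : ℕ) (k : ℚ) (hg : g ≤ r + 1) :
    (shiftedChoose r g).eval (-k) =
      (-1) ^ r * (shiftedChoose r (r + 1 - g)).eval k := by
  simp only [shiftedChoose, eval_mul, eval_C, eval_comp, eval_add, eval_X,
    descPochhammer_eval_eq_prod_range]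
  rw [← Finset.prod_range_reflect, mul_left_comm]
  congr 1
  have h1 : ((-1 : ℚ)) ^ r = ∏ j ∈ Finset.range r, (-1 : ℚ) := by simp
  rw [h1, ← Finset.prod_mul_distrib]
  refine Finset.prod_congr rfl fun j hj => ?_
  have hj' : j + 1 ≤ r := Finset.mem_range.1 hj
  rw [show r - 1 - j = r - (j + 1) by omega, Nat.cast_sub hj', Nat.cast_sub hg]
  push_cast
  ring

variable {E κ : Type*} [AddCommGroup E] [Module ℝ E]

/-- The simplicial cone spanned by a basis, with the facets indexed by `I` removed. -/
def halfOpenCone (b : Basis κ ℝ E) (I : Set κ) : Set E :=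
  {x | ∀ i, 0 ≤ b.repr x i ∧ (i ∈ I → 0 < b.repr x i)}

/-- The half-open fundamental parallelepiped of `halfOpenCone b I`. -/
def halfOpenBox (b : Basis κ ℝ E) (I : Set κ) : Set E :=
  {x | ∀ i, (i ∈ I → 0 < b.repr x i ∧ b.repr x i ≤ 1) ∧
    (i ∉ I → 0 ≤ b.repr x i ∧ b.repr x i < 1)}

theorem exists_nat_of_nonneg (a : ℝ) (ha : 0 ≤ a) :
    ∃ m : ℕ, 0 ≤ a - m ∧ a - m < 1 :=
  ⟨⌊a⌋₊, by linarith [Nat.floor_le ha], by linarith [Nat.lt_floor_add_one a]⟩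

theorem exists_nat_of_pos (a : ℝ) (ha : 0 < a) :
    ∃ m : ℕ, 0 < a - m ∧ a - m ≤ 1 := by
  refine ⟨⌈a⌉₊ - 1, ?_, ?_⟩ <;> rw [Nat.cast_sub (Nat.one_le_ceil_iff.2 ha)] <;> push_cast
  · linarith [Nat.ceil_lt_add_one ha.le]
  · linarith [Nat.le_ceil a]

theorem halfOpenBox_subset (b : Basis κ ℝ E) (I : Set κ) : halfOpenBox b I ⊆ halfOpenCone b I := by
  intro x hx i
  by_cases hi : i ∈ I
  · have := (hx i).1 hi
    exact ⟨this.1.le, fun _ => this.1⟩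
  · have := (hx i).2 hi
    exact ⟨this.1, fun h => absurd h hi⟩

theorem halfOpenBox_repr_le_one (b : Basis κ ℝ E) (I : Set κ) {x : E} (hx : x ∈ halfOpenBox b I)
    (i : κ) : b.repr x i ≤ 1 := by
  by_cases hi : i ∈ I
  · exact ((hx i).1 hi).2
  · exact ((hx i).2 hi).2.le

variable [Fintype κ]

theorem repr_sum_nat_smul (b : Basis κ ℝ E) (m : κ → ℕ) (i : κ) :
    b.repr (∑ j, m j • b j) i = m i := by
  classical
  simp [map_sum, Finsupp.single_apply]

theorem exists_halfOpenBox_add (b : Basis κ ℝ E) (I : Set κ) {x : E} (hx : x ∈ halfOpenCone b I) :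
    ∃ m : κ → ℕ, x - ∑ j, m j • b j ∈ halfOpenBox b I := by
  have h1 : ∀ i, ∃ m : ℕ, (i ∈ I → 0 < b.repr x i - m ∧ b.repr x i - m ≤ 1) ∧
      (i ∉ I → 0 ≤ b.repr x i - m ∧ b.repr x i - m < 1) := by
    intro i
    by_cases hi : i ∈ I
    · obtain ⟨m, hm⟩ := exists_nat_of_pos _ ((hx i).2 hi)
      exact ⟨m, fun _ => hm, fun h => absurd hi h⟩
    · obtain ⟨m, hm⟩ := exists_nat_of_nonneg _ (hx i).1
      exact ⟨m, fun h => absurd h hi, fun _ => hm⟩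
  choose m hm using h1
  refine ⟨m, fun i => ?_⟩
  rw [map_sub, Finsupp.sub_apply, repr_sum_nat_smul]
  exact hm i

theorem halfOpenBox_add_mem (b : Basis κ ℝ E) (I : Set κ) {u : E} (hu : u ∈ halfOpenBox b I)
    (m : κ → ℕ) : u + ∑ j, m j • b j ∈ halfOpenCone b I := by
  intro i
  rw [map_add, Finsupp.add_apply, repr_sum_nat_smul]
  have h := halfOpenBox_subset b I hu i
  have h0 : (0 : ℝ) ≤ m i := Nat.cast_nonneg _
  exact ⟨by linarith [h.1], fun hi => by linarith [h.2 hi]⟩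

theorem halfOpenBox_add_injective (b : Basis κ ℝ E) (I : Set κ) {u u' : E}
    (hu : u ∈ halfOpenBox b I) (hu' : u' ∈ halfOpenBox b I) {m m' : κ → ℕ}
    (h : u + ∑ j, m j • b j = u' + ∑ j, m' j • b j) : u = u' ∧ m = m' := by
  have h1 : m = m' := by
    funext i
    have h2 := congrArg (fun z => b.repr z i) h
    simp only [map_add, Finsupp.add_apply, repr_sum_nat_smul] at h2
    have h3 : (m i : ℝ) < m' i + 1 ∧ (m' i : ℝ) < m i + 1 := by
      by_cases hi : i ∈ I
      · have := (hu i).1 hi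
        have := (hu' i).1 hi
        constructor <;> linarith
      · have := (hu i).2 hi
        have := (hu' i).2 hi
        constructor <;> linarith
    have h4 : m i < m' i + 1 := by exact_mod_cast h3.1
    have h5 : m' i < m i + 1 := by exact_mod_cast h3.2
    omega
  subst h1
  exact ⟨add_right_cancel h, rfl⟩

theorem height_eq_sum_repr (b : Basis κ ℝ E) (h : E →ₗ[ℝ] ℝ) (hb : ∀ i, h (b i) = 1) (x : E) :
    h x = ∑ i, b.repr x i := by
  calc h x = h (∑ i, b.repr x i • b i) := by rw [b.sum_repr x]
    _ = ∑ i, b.repr x i := by simp only [map_sum, map_smul, hb, smul_eq_mul, mul_one]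

theorem halfOpenBox_compl (b : Basis κ ℝ E) (I : Set κ) {u : E} (hu : u ∈ halfOpenBox b I) :
    ∑ i, b i - u ∈ halfOpenBox b Iᶜ := by
  intro i
  have h1 : b.repr (∑ i, b i - u) i = 1 - b.repr u i := by
    have := repr_sum_nat_smul b (fun _ => 1) i
    simp only [one_smul, Nat.cast_one] at this
    rw [map_sub, Finsupp.sub_apply, this]
  rw [h1]
  constructor
  · intro hi
    have := (hu i).2 hi
    constructor <;> linarith
  · intro hi
    have := (hu i).1 (not_not.1 hi)
    constructor <;> linarith

/-- The lattice points of height `k` in a half-open simplicial cone, counted via the fundamental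
parallelepiped. -/
theorem ncard_halfOpenCone_slice (b : Basis κ ℝ E) (L : AddSubgroup E) (h : E →ₗ[ℝ] ℝ)
    (hb : ∀ i, h (b i) = 1) (hbL : ∀ i, b i ∈ L) (I : Set κ) (r : ℕ)
    (hr : Fintype.card κ = r + 1) (U : Finset E)
    (hU : ∀ x, x ∈ U ↔ x ∈ L ∧ x ∈ halfOpenBox b I) (g : E → ℕ) (hg : ∀ x ∈ U, h x = g x)
    (hgr : ∀ x ∈ U, g x ≤ r + 1) (k : ℕ) (hk : 0 < k) :
    ({x | x ∈ L ∧ x ∈ halfOpenCone b I ∧ h x = k}.ncard : ℚ) =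
      ∑ u ∈ U, (shiftedChoose r (g u)).eval (k : ℚ) := by
  classical
  have hsum : ∀ m : κ → ℕ, h (∑ j, m j • b j) = ((∑ j, m j : ℕ) : ℝ) := by
    intro m; simp [map_sum, hb]
  have h1 : {x | x ∈ L ∧ x ∈ halfOpenCone b I ∧ h x = k} =
      ⋃ u ∈ (U : Set E), (fun m : κ → ℕ => u + ∑ j, m j • b j) ''
        {m : κ → ℕ | ∑ i, m i + g u = k} := by
    ext x
    simp only [Set.mem_ofPred_eq, Set.mem_iUnion, Set.mem_image, Finset.mem_coe, exists_prop]
    constructor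
    · rintro ⟨hxL, hxc, hxk⟩
      obtain ⟨m, hm⟩ := exists_halfOpenBox_add b I hxc
      have hmL : ∑ j, m j • b j ∈ L := L.sum_mem fun j _ => L.nsmul_mem (hbL j) _
      have hmU := (hU _).2 ⟨L.sub_mem hxL hmL, hm⟩
      refine ⟨_, hmU, m, ?_, by abel⟩
      have h2 := hg _ hmU
      rw [map_sub, hsum, hxk] at h2
      have h3 : (k : ℝ) = ((∑ j, m j + g (x - ∑ j, m j • b j) : ℕ) : ℝ) := by
        push_cast at h2 ⊢; linarith
      exact_mod_cast h3.symm
    · rintro ⟨u, hu, m, hm, rfl⟩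
      obtain ⟨huL, hub⟩ := (hU u).1 hu
      refine ⟨L.add_mem huL (L.sum_mem fun j _ => L.nsmul_mem (hbL j) _),
        halfOpenBox_add_mem b I hub m, ?_⟩
      rw [map_add, hsum, hg u hu, ← hm]
      push_cast; ring
  have hfin : ∀ u, {m : κ → ℕ | ∑ i, m i + g u = k}.Finite := by
    intro u
    refine (Set.finite_Iic (fun _ : κ => k)).subset fun m hm i => ?_
    have := Finset.single_le_sum (f := m) (fun _ _ => Nat.zero_le _) (Finset.mem_univ i)
    simp only [Set.mem_ofPred_eq] at hm
    show m i ≤ k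
    omega
  rw [h1, U.finite_toSet.ncard_biUnion (fun u _ => (hfin u).image _), finsum_mem_coe_finset,
    Nat.cast_sum]
  · refine Finset.sum_congr rfl fun u hu => ?_
    have hle : g u ≤ k + r := by have := hgr u hu; omega
    rw [Set.ncard_image_of_injective, ncard_nat_tuples_sum_add_eq r (g u) k hr hle,
      shiftedChoose_eval r (g u) k hle]
    intro m m' hmm
    have hub := ((hU u).1 hu).2
    exact (halfOpenBox_add_injective b I hub hub hmm).2
  · intro u hu u' hu' hne
    refine Set.disjoint_left.2 ?_
    rintro x ⟨m, -, rfl⟩ ⟨m', -, hm'⟩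
    exact hne (halfOpenBox_add_injective b I ((hU u').1 hu').2 ((hU u).1 hu).2 hm').1.symm

/-- Reciprocity for half-open simplicial cones. -/
theorem exists_polynomial_halfOpenCone (b : Basis κ ℝ E) (L : AddSubgroup E) (h : E →ₗ[ℝ] ℝ)
    (hb : ∀ i, h (b i) = 1) (hbL : ∀ i, b i ∈ L) (hL : ∀ x ∈ L, ∃ z : ℤ, h x = z)
    (r : ℕ) (hr : Fintype.card κ = r + 1)
    (hfin : ∀ k : ℕ, {x | x ∈ L ∧ x ∈ halfOpenCone b ∅ ∧ h x = k}.Finite) (I : Set κ) :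
    ∃ p : ℚ[X], ∀ k : ℕ, 0 < k →
      p.eval (k : ℚ) = {x | x ∈ L ∧ x ∈ halfOpenCone b I ∧ h x = k}.ncard ∧
      p.eval (-(k : ℚ)) =
        (-1) ^ r * ({x | x ∈ L ∧ x ∈ halfOpenCone b Iᶜ ∧ h x = k}.ncard : ℚ) := by
  classical
  have hheight : ∀ J : Set κ, ∀ x ∈ halfOpenBox b J, 0 ≤ h x ∧ h x ≤ r + 1 := by
    intro J x hx
    rw [height_eq_sum_repr b h hb]
    refine ⟨Finset.sum_nonneg fun i _ => (halfOpenBox_subset b J hx i).1, ?_⟩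
    refine (Finset.sum_le_sum fun i _ => halfOpenBox_repr_le_one b J hx i).trans ?_
    simp [hr]
  let g : E → ℕ := fun x => ⌊h x⌋₊
  have hg : ∀ J : Set κ, ∀ x ∈ L, x ∈ halfOpenBox b J → h x = g x ∧ g x ≤ r + 1 := by
    intro J x hxL hx
    obtain ⟨z, hz⟩ := hL x hxL
    obtain ⟨h0, h1⟩ := hheight J x hx
    rw [hz] at h0 h1
    obtain ⟨m, rfl⟩ := Int.eq_ofNat_of_zero_le (by exact_mod_cast h0 : (0 : ℤ) ≤ z)
    have h2 : h x = (m : ℝ) := by rw [hz]; simp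
    have h3 : g x = m := by simp [g, h2]
    rw [h3]
    exact ⟨h2, by exact_mod_cast h1⟩
  have hUfin : ∀ J : Set κ, {x | x ∈ L ∧ x ∈ halfOpenBox b J}.Finite := by
    intro J
    refine ((Set.finite_Iic (r + 1)).biUnion fun k _ => hfin k).subset ?_
    rintro x ⟨hxL, hx⟩
    simp only [Set.mem_iUnion]
    refine ⟨g x, (hg J x hxL hx).2, hxL, fun i => ⟨(halfOpenBox_subset b J hx i).1, fun hi => ?_⟩,
      (hg J x hxL hx).1⟩
    exact absurd hi (Set.notMem_empty i)
  let U : Set κ → Finset E := fun J => (hUfin J).toFinset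
  have hU : ∀ J x, x ∈ U J ↔ x ∈ L ∧ x ∈ halfOpenBox b J := fun J x => (hUfin J).mem_toFinset
  have count : ∀ (J : Set κ) (k : ℕ), 0 < k → _ := fun J k hk =>
    ncard_halfOpenCone_slice b L h hb hbL J r hr (U J) (hU J) g
      (fun x hx => (hg J x ((hU J x).1 hx).1 ((hU J x).1 hx).2).1)
      (fun x hx => (hg J x ((hU J x).1 hx).1 ((hU J x).1 hx).2).2) k hk
  refine ⟨∑ u ∈ U I, shiftedChoose r (g u), fun k hk => ⟨?_, ?_⟩⟩
  · rw [eval_finsetSum, count I k hk]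
  · rw [eval_finsetSum, count Iᶜ k hk, Finset.mul_sum]
    have hbs : ∑ i, b i ∈ L := L.sum_mem fun i _ => hbL i
    have hhs : h (∑ i, b i) = r + 1 := by simp [map_sum, hb, hr]
    refine Finset.sum_nbij' (fun u => ∑ i, b i - u) (fun u => ∑ i, b i - u) ?_ ?_ ?_ ?_ ?_
    · intro u hu
      rw [hU] at hu ⊢
      exact ⟨L.sub_mem hbs hu.1, halfOpenBox_compl b I hu.2⟩
    · intro u hu
      rw [hU] at hu ⊢
      have := halfOpenBox_compl b Iᶜ hu.2
      rw [compl_compl] at this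
      exact ⟨L.sub_mem hbs hu.1, this⟩
    · intro u _; simp
    · intro u _; simp
    · intro u hu
      rw [hU] at hu
      obtain ⟨h1, h2⟩ := hg I u hu.1 hu.2
      have h3 := (hg Iᶜ _ (L.sub_mem hbs hu.1) (halfOpenBox_compl b I hu.2)).1
      rw [map_sub, hhs, h1] at h3
      have h4 : g (∑ i, b i - u) = r + 1 - g u := by
        have : ((r + 1 : ℕ) : ℝ) = ((g (∑ i, b i - u) + g u : ℕ) : ℝ) := by
          push_cast; linarith
        have : r + 1 = g (∑ i, b i - u) + g u := by exact_mod_cast this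
        omega
      rw [h4, shiftedChoose_eval_neg r (g u) k h2]

end HalfOpenSimplicialCones

section Triangulation

variable {E ι : Type*} [AddCommGroup E] [Module ℝ E]

/-- The convex cone generated by a finite family of vectors. -/
def generatedCone [Fintype ι] (v : ι → E) : Set E :=
  {x | ∃ l : ι → ℝ, (∀ i, 0 ≤ l i) ∧ ∑ i, l i • v i = x}

theorem generatedCone_add_mem [Fintype ι] {v : ι → E} {x y : E} (hx : x ∈ generatedCone v)
    (hy : y ∈ generatedCone v) :
    x + y ∈ generatedCone v := by
  obtain ⟨l, hl, rfl⟩ := hx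
  obtain ⟨m, hm, rfl⟩ := hy
  exact ⟨l + m, fun i => add_nonneg (hl i) (hm i), by
    simp [add_smul, Finset.sum_add_distrib]⟩

theorem generatedCone_smul_mem [Fintype ι] {v : ι → E} {x : E} (hx : x ∈ generatedCone v) {c : ℝ}
    (hc : 0 ≤ c) :
    c • x ∈ generatedCone v := by
  obtain ⟨l, hl, rfl⟩ := hx
  exact ⟨c • l, fun i => mul_nonneg hc (hl i), by simp [mul_smul, Finset.smul_sum]⟩

/-- The sets of indices whose vectors form a basis of the ambient space. -/
abbrev BasicSubset (v : ι → E) :=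
  {B : Finset ι // LinearIndepOn ℝ v (B : Set ι) ∧ B.card = finrank ℝ E}

/-- Ratio test: moving from a nonnegative vector `l` in the direction `-c` until a coordinate
vanishes. -/
theorem exists_ratio_test {α : Type*} [Fintype α] (l c : α → ℝ) (hl : ∀ i, 0 ≤ l i)
    (hc : ∃ i, 0 < c i) :
    ∃ t : ℝ, 0 ≤ t ∧ (∀ i, 0 ≤ l i - t * c i) ∧ ∃ i, 0 < c i ∧ l i = t * c i := by
  classical
  obtain ⟨i₀, hi₀⟩ := hc
  obtain ⟨j, hj, hmin⟩ := (Finset.univ.filter fun i => 0 < c i).exists_min_image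
    (fun i => l i / c i) ⟨i₀, by simpa using hi₀⟩
  have hj : 0 < c j := by simpa using hj
  have ht : 0 ≤ l j / c j := div_nonneg (hl j) hj.le
  refine ⟨l j / c j, ht, fun i => ?_, j, hj, by field_simp⟩
  by_cases hi : 0 < c i
  · have h1 := hmin i (by simpa using hi)
    rw [le_div_iff₀ hi] at h1
    linarith
  · have := mul_nonneg ht (neg_nonneg.2 (not_lt.1 hi))
    have := hl i
    linarith

variable {v : ι → E}

namespace BasicSubset

variable [FiniteDimensional ℝ E]

/-- The basis of the ambient space given by a basic subset. -/
noncomputable def basis (T : BasicSubset v) : Basis (T.1 : Set ι) ℝ E :=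
  Basis.mk (v := fun i : (T.1 : Set ι) => v i) T.2.1
    (LinearIndependent.span_eq_top_of_card_eq_finrank' T.2.1 (by simpa using T.2.2)).ge

theorem basis_apply (T : BasicSubset v) (i : (T.1 : Set ι)) : T.basis i = v i := by
  simp [basis]

open Classical in
/-- Coordinates with respect to a basic subset, extended by zero. -/
noncomputable def coords (T : BasicSubset v) : E →ₗ[ℝ] (ι → ℝ) :=
  LinearMap.pi fun i => if hi : i ∈ T.1 then T.basis.coord ⟨i, hi⟩ else 0

theorem coords_of_mem (T : BasicSubset v) (x : E) {i : ι} (hi : i ∈ T.1) :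
    T.coords x i = T.basis.repr x ⟨i, hi⟩ := by
  simp [coords, hi]

theorem coords_of_notMem (T : BasicSubset v) (x : E) {i : ι} (hi : i ∉ T.1) :
    T.coords x i = 0 := by
  simp [coords, hi]

theorem sum_coords [Fintype ι] (T : BasicSubset v) (x : E) : ∑ i, T.coords x i • v i = x := by
  have h1 : ∑ i ∈ T.1, T.coords x i • v i = x := by
    rw [← Finset.sum_coe_sort]
    conv_rhs => rw [← T.basis.sum_repr x]
    refine Finset.sum_congr rfl fun i _ => ?_
    rw [T.coords_of_mem x i.2, basis_apply]
    rfl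
  conv_rhs => rw [← h1]
  refine (Finset.sum_subset (Finset.subset_univ _) fun i _ hi => ?_).symm
  rw [T.coords_of_notMem x hi, zero_smul]

theorem coords_apply_of_mem [DecidableEq ι] (T : BasicSubset v) {i : ι} (hi : i ∈ T.1) :
    T.coords (v i) = Pi.single i 1 := by
  have h1 : v i = T.basis ⟨i, hi⟩ := (T.basis_apply ⟨i, hi⟩).symm
  funext j
  by_cases hj : j ∈ T.1
  · rw [T.coords_of_mem _ hj, h1, Basis.repr_self, Finsupp.single_apply, Pi.single_apply]
    simp only [Subtype.mk.injEq, eq_comm]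
  · rw [T.coords_of_notMem _ hj, Pi.single_eq_of_ne]
    rintro rfl
    exact hj hi

theorem mem_halfOpenCone_iff (T : BasicSubset v) (I : Set (T.1 : Set ι)) (x : E) :
    x ∈ halfOpenCone T.basis I ↔
      ∀ i, ∀ hi : i ∈ T.1, 0 ≤ T.coords x i ∧ (⟨i, hi⟩ ∈ I → 0 < T.coords x i) := by
  constructor
  · intro h i hi
    rw [T.coords_of_mem x hi]
    exact h ⟨i, hi⟩
  · rintro h ⟨i, hi⟩
    have := h i hi
    rw [T.coords_of_mem x hi] at this
    exact this

variable [Fintype ι]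

theorem coords_unique (T : BasicSubset v) {l : ι → ℝ} (hl : ∀ i, i ∉ T.1 → l i = 0) {x : E}
    (hx : ∑ i, l i • v i = x) : T.coords x = l := by
  classical
  have h1 : ∀ i, l i • T.coords (v i) = Pi.single i (l i) := by
    intro i
    by_cases hi : i ∈ T.1
    · rw [T.coords_apply_of_mem hi, ← Pi.single_smul]
      simp
    · simp [hl i hi]
  rw [← hx]
  simp only [map_sum, map_smul, h1]
  exact Finset.univ_sum_single l

/-- The linear functional taking the value `w i` at `v i` for each `i` in the basic subset. -/
noncomputable def cost (w : ι → ℝ) (T : BasicSubset v) : E →ₗ[ℝ] ℝ :=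
  Fintype.linearCombination ℝ w ∘ₗ T.coords

theorem cost_eq (w : ι → ℝ) (T : BasicSubset v) (x : E) :
    T.cost w x = ∑ i, T.coords x i * w i := by
  simp [cost, Fintype.linearCombination_apply]

/-- A basic subset belongs to the regular subdivision defined by `w` if all vectors lie on or
above the hyperplane through the lifted vectors of the subset. -/
def Feasible (w : ι → ℝ) (T : BasicSubset v) : Prop :=
  ∀ s, T.cost w (v s) ≤ w s

theorem mem_generatedCone (T : BasicSubset v) {x : E} (hx : ∀ i, 0 ≤ T.coords x i) :
    x ∈ generatedCone v :=
  ⟨T.coords x, hx, T.sum_coords x⟩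

end BasicSubset

open BasicSubset

/-- Exchanging an element of a basic subset for another index. -/
theorem exists_basicSubset_exchange [FiniteDimensional ℝ E] (T : BasicSubset v) {s j : ι}
    (hs : s ∉ T.1) (hj : j ∈ T.1) (hc : T.coords (v s) j ≠ 0) :
    ∃ T' : BasicSubset v, ∀ i, i ∉ T'.1 → i ≠ s ∧ (i ∉ T.1 ∨ i = j) := by
  classical
  have hind : LinearIndepOn ℝ v ((insert s (T.1.erase j) : Finset ι) : Set ι) := by
    rw [Finset.coe_insert]
    refine (T.2.1.mono (by simp)).insert fun hmem => hc ?_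
    have hle : Submodule.span ℝ (v '' (T.1.erase j : Finset ι)) ≤
        LinearMap.ker (LinearMap.proj j ∘ₗ T.coords) := by
      refine Submodule.span_le.2 ?_
      rintro _ ⟨i, hi, rfl⟩
      obtain ⟨hij, hi⟩ := Finset.mem_erase.1 (Finset.mem_coe.1 hi)
      simp [T.coords_apply_of_mem hi, hij.symm]
    exact hle hmem
  refine ⟨⟨_, hind, ?_⟩, fun i hi => ?_⟩
  · rw [Finset.card_insert_of_notMem (fun h => hs (Finset.mem_of_mem_erase h)),
      Finset.card_erase_of_mem hj]
    have h1 := T.2.2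
    have := Finset.card_pos.2 ⟨j, hj⟩
    omega
  · simp only [Finset.mem_insert, Finset.mem_erase] at hi
    tauto

variable [Fintype ι]

/-- Carathéodory's theorem for cones generated by vectors of height one. -/
theorem exists_basicSubset_coords_nonneg [FiniteDimensional ℝ E] (h : E →ₗ[ℝ] ℝ)
    (hv : ∀ i, h (v i) = 1) (hspan : Submodule.span ℝ (Set.range v) = ⊤) {x : E}
    (hx : x ∈ generatedCone v) : ∃ T : BasicSubset v, ∀ i, 0 ≤ T.coords x i := by
  classical
  obtain ⟨l, hl, hlx⟩ := hx
  induction hn : (Finset.univ.filter fun i => l i ≠ 0).card using Nat.strong_induction_on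
    generalizing l with
  | _ n ih =>
  set s := Finset.univ.filter fun i => l i ≠ 0 with hs
  by_cases hind : LinearIndepOn ℝ v (s : Set ι)
  · obtain ⟨b, -, hsb, hb, hbi⟩ := exists_linearIndepOn_extension hind (Set.subset_univ _)
    have hb' : Submodule.span ℝ (v '' b) = ⊤ := by
      rw [eq_top_iff, ← hspan, ← Set.image_univ]
      exact Submodule.span_le.2 hb
    have hcard : b.toFinset.card = finrank ℝ E := by
      have h1 := finrank_span_eq_card (R := ℝ) hbi
      rw [show Set.range (fun i : b => v i) = v '' b by rw [Set.image_eq_range], hb',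
        finrank_top] at h1
      rw [h1, Set.toFinset_card]
    let T : BasicSubset v := ⟨b.toFinset, by rwa [Set.coe_toFinset], hcard⟩
    refine ⟨T, ?_⟩
    rw [T.coords_unique (l := l) _ hlx]
    · exact hl
    · intro i hi
      by_contra hne
      exact hi (Set.mem_toFinset.2 (hsb (by simp [hs, hne])))
  · rw [linearIndepOn_finset_iff] at hind
    push Not at hind
    obtain ⟨f, hf, j, hj, hfj⟩ := hind
    let c : ι → ℝ := fun i => if i ∈ s then f i else 0
    have hc : ∑ i, c i • v i = 0 := by
      rw [← hf]
      simp only [c, ite_smul, zero_smul]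
      rw [Finset.sum_ite_mem, Finset.univ_inter]
    have hc1 : ∑ i, c i = 0 := by
      have := congrArg h hc
      simpa [map_sum, hv] using this
    have hpos : ∃ i, 0 < c i := by
      by_contra! hneg
      have := (Finset.sum_eq_zero_iff_of_nonpos fun i _ => hneg i).1 hc1 j (Finset.mem_univ j)
      simp only [c, hj, if_true] at this
      exact hfj this
    obtain ⟨t, -, ht, i, hci, hi⟩ := exists_ratio_test l c hl hpos
    refine ih _ ?_ (fun i => l i - t * c i) ht ?_ rfl
    · rw [← hn]
      refine Finset.card_lt_card ((Finset.ssubset_iff_of_subset ?_).2 ⟨i, ?_, ?_⟩)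
      · intro k hk
        rw [Finset.mem_filter] at hk
        by_contra hks
        have hlk : l k = 0 := by
          by_contra hne
          exact hks (by simp [hs, hne])
        exact hk.2 (by simp [c, hks, hlk])
      · by_contra his
        simp [c, his] at hci
      · simp [hi]
    · simp only [sub_smul, Finset.sum_sub_distrib, mul_smul, ← Finset.smul_sum, hc, hlx]
      simp

/-- A generic point of the cone lies in a cone of the regular subdivision: the pivot step of the
simplex method. -/
theorem exists_feasible_coords_nonneg [FiniteDimensional ℝ E] (h : E →ₗ[ℝ] ℝ)
    (hv : ∀ i, h (v i) = 1) (hspan : Submodule.span ℝ (Set.range v) = ⊤) (w : ι → ℝ) {x : E}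
    (hx : x ∈ generatedCone v) (hgen : ∀ T : BasicSubset v, ∀ i ∈ T.1, T.coords x i ≠ 0) :
    ∃ T : BasicSubset v, T.Feasible w ∧ ∀ i, 0 ≤ T.coords x i := by
  classical
  obtain ⟨T, hT, hmin⟩ := Set.exists_min_image {T : BasicSubset v | ∀ i, 0 ≤ T.coords x i}
    (fun T => T.cost w x) (Set.toFinite _) (exists_basicSubset_coords_nonneg h hv hspan hx)
  refine ⟨T, fun s => ?_, hT⟩
  by_contra! hlt
  have hs : s ∉ T.1 := by
    intro hs
    rw [T.cost_eq, T.coords_apply_of_mem hs] at hlt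
    simp [Pi.single_apply] at hlt
  have hsum : ∑ i, T.coords (v s) i = 1 := by
    have := congrArg h (T.sum_coords (v s))
    simpa [map_sum, hv] using this
  have hpos : ∃ i, 0 < T.coords (v s) i := by
    by_contra! hneg
    have := Finset.sum_nonpos fun i (_ : i ∈ Finset.univ) => hneg i
    linarith
  obtain ⟨t, ht, htl, j, hcj, hj⟩ := exists_ratio_test (T.coords x) (T.coords (v s)) hT hpos
  have hjT : j ∈ T.1 := by
    by_contra hjT
    rw [T.coords_of_notMem _ hjT] at hcj
    exact hcj.false
  have ht' : 0 < t := by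
    refine ht.lt_of_ne fun h0 => hgen T j hjT ?_
    rw [hj, ← h0, zero_mul]
  obtain ⟨T', hT'⟩ := exists_basicSubset_exchange T hs hjT hcj.ne'
  let l : ι → ℝ := fun i => T.coords x i - t * T.coords (v s) i + if i = s then t else 0
  have hl : T'.coords x = l := by
    refine T'.coords_unique (fun i hi => ?_) ?_
    · obtain ⟨his, hi⟩ := hT' i hi
      rcases hi with hi | rfl
      · simp [l, his, T.coords_of_notMem _ hi]
      · simp [l, his, hj]
    · simp only [l, add_smul, sub_smul, Finset.sum_add_distrib, Finset.sum_sub_distrib, mul_smul,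
        ← Finset.smul_sum, T.sum_coords]
      simp
  have h1 : T'.cost w x = T.cost w x - t * T.cost w (v s) + t * w s := by
    rw [cost_eq, hl, cost_eq, cost_eq]
    simp only [l, add_mul, sub_mul, Finset.sum_add_distrib, Finset.sum_sub_distrib, mul_assoc,
      ← Finset.mul_sum]
    simp
  have h2 : T.cost w x ≤ T'.cost w x := by
    refine hmin T' fun i => ?_
    rw [hl]
    have := htl i
    simp only [l]
    split_ifs <;> linarith
  have h3 := mul_lt_mul_of_pos_left hlt ht'
  linarith

theorem cost_le_cost [FiniteDimensional ℝ E] {w : ι → ℝ} {x : E} {T T' : BasicSubset v}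
    (hT : T.Feasible w) (hT' : ∀ i, 0 ≤ T'.coords x i) : T.cost w x ≤ T'.cost w x := by
  conv_lhs => rw [← T'.sum_coords x]
  rw [cost_eq w T', map_sum]
  refine Finset.sum_le_sum fun i _ => ?_
  rw [map_smul, smul_eq_mul]
  exact mul_le_mul_of_nonneg_left (hT i) (hT' i)

theorem feasible_unique [FiniteDimensional ℝ E] {w : ι → ℝ}
    (hw : ∀ T : BasicSubset v, ∀ s, s ∉ T.1 → T.cost w (v s) ≠ w s) {x : E}
    (hgen : ∀ T : BasicSubset v, ∀ i ∈ T.1, T.coords x i ≠ 0) {T T' : BasicSubset v}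
    (hT : T.Feasible w) (hTx : ∀ i, 0 ≤ T.coords x i) (hT' : T'.Feasible w)
    (hTx' : ∀ i, 0 ≤ T'.coords x i) : T = T' := by
  have heq : T.cost w x = T'.cost w x :=
    le_antisymm (cost_le_cost hT hTx') (cost_le_cost hT' hTx)
  have h1 : ∑ i, T'.coords x i * (w i - T.cost w (v i)) = 0 := by
    simp only [mul_sub, Finset.sum_sub_distrib]
    rw [← cost_eq, ← heq, sub_eq_zero]
    conv_lhs => rw [← T'.sum_coords x]
    simp only [map_sum, map_smul, smul_eq_mul]
  rw [Finset.sum_eq_zero_iff_of_nonneg fun i _ =>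
    mul_nonneg (hTx' i) (sub_nonneg.2 (hT i))] at h1
  have hsub : T'.1 ⊆ T.1 := by
    intro i hi
    by_contra hiT
    rcases mul_eq_zero.1 (h1 i (Finset.mem_univ i)) with h2 | h2
    · exact hgen T' i hi h2
    · exact hw T i hiT (sub_eq_zero.1 h2).symm
  exact Subtype.ext (Finset.eq_of_subset_of_card_le hsub (by rw [T.2.2, T'.2.2])).symm

/-- Finitely many nonzero linear functionals are simultaneously nonzero somewhere on any nonempty
open set. -/
theorem exists_mem_forall_linear_ne_zero {V α : Type*} [NormedAddCommGroup V] [NormedSpace ℝ V]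
    [FiniteDimensional ℝ V] [Finite α] (f : α → V →ₗ[ℝ] ℝ) (hf : ∀ a, f a ≠ 0) {O : Set V}
    (hO : IsOpen O) (hne : O.Nonempty) : ∃ x ∈ O, ∀ a, f a x ≠ 0 := by
  have : CompleteSpace V := FiniteDimensional.complete ℝ V
  have hd : Dense (⋂ a, {x | f a x ≠ 0}) := by
    refine dense_iInter_of_isOpen (fun a => ?_) fun a => ?_
    · exact isOpen_ne.preimage (f a).continuous_of_finiteDimensional
    · have hint : interior (LinearMap.ker (f a) : Set V) = ∅ := by
        by_contra hint
        exact hf a (LinearMap.ker_eq_top.1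
          (Submodule.eq_top_of_nonempty_interior' _ (Set.nonempty_iff_ne_empty.2 hint)))
      exact interior_eq_empty_iff_dense_compl.1 hint
  obtain ⟨x, hxO, hx⟩ := hd.inter_open_nonempty O hO hne
  exact ⟨x, hxO, fun a => Set.mem_iInter.1 hx a⟩

theorem exists_generic_weight [FiniteDimensional ℝ E] (v : ι → E) :
    ∃ w : ι → ℝ, ∀ T : BasicSubset v, ∀ s, s ∉ T.1 → T.cost w (v s) ≠ w s := by
  classical
  let f : {a : BasicSubset v × ι // a.2 ∉ a.1.1} → (ι → ℝ) →ₗ[ℝ] ℝ := fun a =>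
    LinearMap.proj a.1.2 - Fintype.linearCombination ℝ (a.1.1.coords (v a.1.2))
  have hf : ∀ a w, f a w = w a.1.2 - a.1.1.cost w (v a.1.2) := by
    intro a w
    simp [f, cost_eq, Fintype.linearCombination_apply, mul_comm]
  have hf0 : ∀ a, f a ≠ 0 := by
    intro a h0
    have h1 := LinearMap.congr_fun h0 (Pi.single a.1.2 1)
    rw [hf, cost_eq] at h1
    simp [Pi.single_apply, coords_of_notMem _ _ a.2] at h1
  obtain ⟨w, -, hw⟩ := exists_mem_forall_linear_ne_zero f hf0 isOpen_univ Set.univ_nonempty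
  refine ⟨w, fun T s hs heq => hw ⟨(T, s), hs⟩ ?_⟩
  rw [hf, sub_eq_zero]
  exact heq.symm

theorem eventually_perturbation (a c : ℝ) (hc : c ≠ 0) :
    ∀ᶠ ε in nhdsWithin (0 : ℝ) (Set.Ioi 0),
      a + ε * c ≠ 0 ∧ (0 ≤ a + ε * c ↔ 0 ≤ a ∧ (c < 0 → 0 < a)) := by
  have hpos : ∀ᶠ ε in nhdsWithin (0 : ℝ) (Set.Ioi 0), 0 < ε := self_mem_nhdsWithin
  rcases lt_trichotomy a 0 with ha | rfl | ha
  · have hlim : Filter.Tendsto (fun ε : ℝ => a + ε * c) (nhdsWithin 0 (Set.Ioi 0)) (nhds a) := by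
      refine Filter.Tendsto.mono_left ?_ nhdsWithin_le_nhds
      exact (Continuous.tendsto' (by fun_prop) _ _ (by simp))
    filter_upwards [hlim.eventually_lt_const ha] with ε h1
    refine ⟨h1.ne, ?_⟩
    constructor
    · intro h2; linarith
    · intro h2; linarith [h2.1]
  · filter_upwards [hpos] with ε hε
    simp only [zero_add, le_refl, lt_irrefl, true_and, imp_false, not_lt]
    exact ⟨mul_ne_zero hε.ne' hc, mul_nonneg_iff_of_pos_left hε⟩
  · have hlim : Filter.Tendsto (fun ε : ℝ => a + ε * c) (nhdsWithin 0 (Set.Ioi 0)) (nhds a) := by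
      refine Filter.Tendsto.mono_left ?_ nhdsWithin_le_nhds
      exact (Continuous.tendsto' (by fun_prop) _ _ (by simp))
    filter_upwards [hlim.eventually_const_lt ha] with ε h1
    exact ⟨h1.ne', iff_of_true h1.le ⟨ha.le, fun _ => ha⟩⟩

/-- Perturbing a point in a generic direction `q` decides which half-open cone it belongs to. -/
theorem eventually_halfOpenCone [FiniteDimensional ℝ E] {q : E}
    (hq : ∀ T : BasicSubset v, ∀ i ∈ T.1, T.coords q i ≠ 0) (x : E) :
    ∀ᶠ ε in nhdsWithin (0 : ℝ) (Set.Ioi 0), ∀ T : BasicSubset v,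
      (∀ i ∈ T.1, T.coords (x + ε • q) i ≠ 0) ∧
      ((∀ i, 0 ≤ T.coords (x + ε • q) i) ↔
        x ∈ halfOpenCone T.basis {i | T.coords q i < 0}) := by
  have h1 : ∀ᶠ ε in nhdsWithin (0 : ℝ) (Set.Ioi 0), ∀ T : BasicSubset v, ∀ i, i ∈ T.1 →
      T.coords (x + ε • q) i ≠ 0 ∧ (0 ≤ T.coords (x + ε • q) i ↔
        0 ≤ T.coords x i ∧ (T.coords q i < 0 → 0 < T.coords x i)) := by
    rw [Filter.eventually_all]
    intro T
    rw [Filter.eventually_all]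
    intro i
    by_cases hi : i ∈ T.1
    · filter_upwards [eventually_perturbation (T.coords x i) (T.coords q i) (hq T i hi)] with ε h _
      simpa using h
    · exact Filter.Eventually.of_forall fun ε h => absurd h hi
  filter_upwards [h1] with ε h T
  refine ⟨fun i hi => (h T i hi).1, ?_⟩
  rw [mem_halfOpenCone_iff]
  constructor
  · intro h2 i hi
    exact (h T i hi).2.1 (h2 i)
  · intro h2 i
    by_cases hi : i ∈ T.1
    · exact (h T i hi).2.2 (h2 i hi)
    · rw [T.coords_of_notMem _ hi]

/-- For a generic direction `q`, the points that enter the cone when moved in direction `q` are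
partitioned by the half-open cones of a regular triangulation. -/
theorem eventually_generatedCone_iff [FiniteDimensional ℝ E] (h : E →ₗ[ℝ] ℝ)
    (hv : ∀ i, h (v i) = 1) (hspan : Submodule.span ℝ (Set.range v) = ⊤) {w : ι → ℝ}
    (hw : ∀ T : BasicSubset v, ∀ s, s ∉ T.1 → T.cost w (v s) ≠ w s) {q : E}
    (hq : ∀ T : BasicSubset v, ∀ i ∈ T.1, T.coords q i ≠ 0) (x : E) :
    (∀ᶠ ε in nhdsWithin (0 : ℝ) (Set.Ioi 0), x + ε • q ∈ generatedCone v ↔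
      ∃ T : BasicSubset v, T.Feasible w ∧ x ∈ halfOpenCone T.basis {i | T.coords q i < 0}) ∧
    ∀ T T' : BasicSubset v, T.Feasible w → x ∈ halfOpenCone T.basis {i | T.coords q i < 0} →
      T'.Feasible w → x ∈ halfOpenCone T'.basis {i | T'.coords q i < 0} → T = T' := by
  have hev := eventually_halfOpenCone hq x
  constructor
  · filter_upwards [hev] with ε hε
    constructor
    · intro hx
      obtain ⟨T, hT, hTx⟩ := exists_feasible_coords_nonneg h hv hspan w hx fun T => (hε T).1
      exact ⟨T, hT, (hε T).2.1 hTx⟩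
    · rintro ⟨T, -, hTx⟩
      exact T.mem_generatedCone ((hε T).2.2 hTx)
  · intro T T' hT hTx hT' hTx'
    obtain ⟨ε, hε⟩ := hev.exists
    exact feasible_unique hw (fun T => (hε T).1) hT ((hε T).2.2 hTx) hT' ((hε T').2.2 hTx')

end Triangulation

section ConeReciprocity

variable {E ι : Type*} [NormedAddCommGroup E] [NormedSpace ℝ E] [Fintype ι]
  {v : ι → E}

open BasicSubset

theorem mem_interior_generatedCone_iff {q : E} (hq : q ∈ interior (generatedCone v)) (x : E) :
    (x ∈ interior (generatedCone v) →
      ∀ᶠ ε in nhdsWithin (0 : ℝ) (Set.Ioi 0), x + ε • (-q) ∈ generatedCone v) ∧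
    (∀ ε : ℝ, 0 < ε → x + ε • (-q) ∈ generatedCone v → x ∈ interior (generatedCone v)) := by
  constructor
  · intro hx
    have hlim : Filter.Tendsto (fun ε : ℝ => x + ε • (-q)) (nhdsWithin 0 (Set.Ioi 0))
        (nhds x) := by
      refine Filter.Tendsto.mono_left ?_ nhdsWithin_le_nhds
      exact (Continuous.tendsto' (by fun_prop) _ _ (by simp))
    exact hlim.eventually (mem_interior_iff_mem_nhds.1 hx)
  · intro ε hε hx
    have hcont : Continuous fun y : E => ε⁻¹ • (y - (x + ε • (-q))) := by fun_prop
    refine mem_interior.2 ⟨(fun y : E => ε⁻¹ • (y - (x + ε • (-q)))) ⁻¹'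
      interior (generatedCone v), fun y hy => ?_, isOpen_interior.preimage hcont, ?_⟩
    · have h1 := generatedCone_smul_mem (interior_subset hy) hε.le
      have h2 := generatedCone_add_mem hx h1
      rwa [smul_inv_smul₀ hε.ne', add_sub_cancel] at h2
    · simp only [Set.mem_preimage]
      convert hq using 1
      rw [smul_neg, sub_add_eq_sub_sub, sub_self, zero_sub, neg_neg, inv_smul_smul₀ hε.ne']

variable [FiniteDimensional ℝ E]

theorem interior_generatedCone_nonempty (hspan : Submodule.span ℝ (Set.range v) = ⊤) :
    (interior (generatedCone v)).Nonempty := by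
  have hsurj : Function.Surjective (Fintype.linearCombination ℝ v) := by
    rw [← LinearMap.range_eq_top, Fintype.range_linearCombination, hspan]
  have hopen := LinearMap.isOpenMap_of_finiteDimensional _ hsurj
  have hO : IsOpen (Set.univ.pi fun _ : ι => Set.Ioi (0 : ℝ)) :=
    isOpen_set_pi Set.finite_univ fun _ _ => isOpen_Ioi
  refine ⟨_, interior_maximal ?_ (hopen _ hO) ⟨fun _ => 1, fun _ _ => Set.mem_Ioi.2 one_pos, rfl⟩⟩
  rintro _ ⟨l, hl, rfl⟩
  exact ⟨l, fun i => (hl i trivial).le, (Fintype.linearCombination_apply ℝ v l).symm⟩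

theorem exists_generic_mem_interior (hspan : Submodule.span ℝ (Set.range v) = ⊤) :
    ∃ q ∈ interior (generatedCone v), ∀ T : BasicSubset v, ∀ i ∈ T.1, T.coords q i ≠ 0 := by
  classical
  let f : {a : BasicSubset v × ι // a.2 ∈ a.1.1} → E →ₗ[ℝ] ℝ := fun a =>
    LinearMap.proj a.1.2 ∘ₗ a.1.1.coords
  have hf0 : ∀ a, f a ≠ 0 := by
    intro a h0
    have h1 := LinearMap.congr_fun h0 (v a.1.2)
    simp [f, a.1.1.coords_apply_of_mem a.2] at h1
  obtain ⟨q, hq, hgen⟩ := exists_mem_forall_linear_ne_zero f hf0 isOpen_interior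
    (interior_generatedCone_nonempty hspan)
  exact ⟨q, hq, fun T i hi => hgen ⟨(T, i), hi⟩⟩

/-- A cone and its interior are partitioned by complementary families of half-open simplicial
cones. -/
theorem exists_halfOpen_decomposition (h : E →ₗ[ℝ] ℝ)
    (hv : ∀ i, h (v i) = 1) (hspan : Submodule.span ℝ (Set.range v) = ⊤) :
    ∃ (F : Set (BasicSubset v)) (I : ∀ T : BasicSubset v, Set (T.1 : Set ι)),
      (generatedCone v = ⋃ T ∈ F, halfOpenCone T.basis (I T)) ∧
      (F.PairwiseDisjoint fun T => halfOpenCone T.basis (I T)) ∧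
      (interior (generatedCone v) = ⋃ T ∈ F, halfOpenCone T.basis (I T)ᶜ) ∧
      (F.PairwiseDisjoint fun T => halfOpenCone T.basis (I T)ᶜ) := by
  obtain ⟨w, hw⟩ := exists_generic_weight v
  obtain ⟨q, hqint, hq⟩ := exists_generic_mem_interior hspan
  have hq' : ∀ T : BasicSubset v, ∀ i ∈ T.1, T.coords (-q) i ≠ 0 := by
    intro T i hi
    simpa using hq T i hi
  have hcompl : ∀ T : BasicSubset v, {i : (T.1 : Set ι) | T.coords (-q) i < 0} =
      {i : (T.1 : Set ι) | T.coords q i < 0}ᶜ := by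
    intro T
    ext i
    simp only [map_neg, Pi.neg_apply, Left.neg_neg_iff, Set.mem_ofPred_eq, Set.mem_compl_iff,
      not_lt]
    exact ⟨le_of_lt, fun h => h.lt_of_ne (hq T i i.2).symm⟩
  have hpos : ∀ᶠ ε in nhdsWithin (0 : ℝ) (Set.Ioi 0), 0 < ε := self_mem_nhdsWithin
  refine ⟨{T | T.Feasible w}, fun T => {i | T.coords q i < 0}, ?_, ?_, ?_, ?_⟩
  · ext x
    simp only [Set.mem_iUnion, Set.mem_ofPred_eq, exists_prop]
    obtain ⟨h1, -⟩ := eventually_generatedCone_iff h hv hspan hw hq x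
    constructor
    · intro hx
      obtain ⟨ε, h2, hε⟩ := (h1.and hpos).exists
      exact h2.1 (generatedCone_add_mem hx (generatedCone_smul_mem (interior_subset hqint) hε.le))
    · rintro ⟨T, -, hTx⟩
      refine T.mem_generatedCone fun i => ?_
      by_cases hi : i ∈ T.1
      · exact ((T.mem_halfOpenCone_iff _ x).1 hTx i hi).1
      · rw [T.coords_of_notMem _ hi]
  · intro T hT T' hT' hne
    refine Set.disjoint_left.2 fun x hx hx' => hne ?_
    exact (eventually_generatedCone_iff h hv hspan hw hq x).2 T T' hT hx hT' hx'
  · ext x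
    simp only [Set.mem_iUnion, Set.mem_ofPred_eq, exists_prop]
    obtain ⟨h1, -⟩ := eventually_generatedCone_iff h hv hspan hw hq' x
    simp only [hcompl] at h1
    obtain ⟨h3, h4⟩ := mem_interior_generatedCone_iff hqint x
    constructor
    · intro hx
      obtain ⟨ε, h2, hε⟩ := (h1.and (h3 hx)).exists
      exact h2.1 hε
    · intro hx
      obtain ⟨ε, h2, hε⟩ := (h1.and hpos).exists
      exact h4 ε hε (h2.2 hx)
  · intro T hT T' hT' hne
    refine Set.disjoint_left.2 fun x hx hx' => hne ?_
    simp only [← hcompl] at hx hx'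
    exact (eventually_generatedCone_iff h hv hspan hw hq' x).2 T T' hT hx hT' hx'

theorem ncard_slice_biUnion {α β : Type*} [Finite β] (L : Set α) (H : α → Prop) (F : Set β)
    (c : β → Set α) (hc : F.PairwiseDisjoint c) (X : Set α) (hX : X = ⋃ T ∈ F, c T)
    (hfin : {x | x ∈ L ∧ x ∈ X ∧ H x}.Finite) :
    {x | x ∈ L ∧ x ∈ X ∧ H x}.ncard =
      ∑ T ∈ F.toFinite.toFinset, {x | x ∈ L ∧ x ∈ c T ∧ H x}.ncard := by
  have h1 : {x | x ∈ L ∧ x ∈ X ∧ H x} = ⋃ T ∈ F, {x | x ∈ L ∧ x ∈ c T ∧ H x} := by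
    ext x
    simp only [hX, Set.mem_iUnion, Set.mem_ofPred_eq, exists_prop]
    tauto
  rw [h1] at hfin
  rw [h1, F.toFinite.ncard_biUnion]
  · exact finsum_mem_eq_finite_toFinset_sum _ F.toFinite
  · exact fun T hT => hfin.subset
      (Set.subset_biUnion_of_mem (u := fun T => {x | x ∈ L ∧ x ∈ c T ∧ H x}) hT)
  · exact hc.mono fun T x hx => hx.2.1

/-- Ehrhart reciprocity for the slices of a cone generated by lattice vectors of height one. -/
theorem exists_polynomial_generatedCone (h : E →ₗ[ℝ] ℝ) (hv : ∀ i, h (v i) = 1)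
    (hspan : Submodule.span ℝ (Set.range v) = ⊤) (L : AddSubgroup E) (hvL : ∀ i, v i ∈ L)
    (hL : ∀ x ∈ L, ∃ z : ℤ, h x = z)
    (hfin : ∀ k : ℕ, {x | x ∈ L ∧ x ∈ generatedCone v ∧ h x = k}.Finite) (r : ℕ)
    (hr : finrank ℝ E = r + 1) :
    ∃ p : ℚ[X], ∀ k : ℕ, 0 < k →
      p.eval (k : ℚ) = {x | x ∈ L ∧ x ∈ generatedCone v ∧ h x = k}.ncard ∧
      p.eval (-(k : ℚ)) =
        (-1) ^ r * ({x | x ∈ L ∧ x ∈ interior (generatedCone v) ∧ h x = k}.ncard : ℚ) := by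
  obtain ⟨F, I, hF, hFd, hF', hFd'⟩ := exists_halfOpen_decomposition h hv hspan
  have hpiece : ∀ T : BasicSubset v, ∃ p : ℚ[X], ∀ k : ℕ, 0 < k →
      p.eval (k : ℚ) = {x | x ∈ L ∧ x ∈ halfOpenCone T.basis (I T) ∧ h x = k}.ncard ∧
      p.eval (-(k : ℚ)) =
        (-1) ^ r * ({x | x ∈ L ∧ x ∈ halfOpenCone T.basis (I T)ᶜ ∧ h x = k}.ncard : ℚ) := by
    intro T
    refine exists_polynomial_halfOpenCone T.basis L h (fun i => ?_) (fun i => ?_) hL r ?_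
      (fun k => (hfin k).subset ?_) (I T)
    · rw [T.basis_apply, hv]
    · rw [T.basis_apply]; exact hvL _
    · have := T.2.2
      simp only [Finset.coe_sort_coe, Fintype.card_coe]
      omega
    · rintro x ⟨hxL, hx, hxk⟩
      refine ⟨hxL, T.mem_generatedCone fun i => ?_, hxk⟩
      by_cases hi : i ∈ T.1
      · exact ((T.mem_halfOpenCone_iff _ x).1 hx i hi).1
      · rw [T.coords_of_notMem _ hi]
  choose p hp using hpiece
  refine ⟨∑ T ∈ F.toFinite.toFinset, p T, fun k hk => ⟨?_, ?_⟩⟩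
  · have := ncard_slice_biUnion (L : Set E) (fun x => h x = k) F _ hFd _ hF (hfin k)
    simp only [SetLike.mem_coe] at this
    rw [this, eval_finsetSum, Nat.cast_sum]
    exact Finset.sum_congr rfl fun T _ => (hp T k hk).1
  · have := ncard_slice_biUnion (L : Set E) (fun x => h x = k) F _ hFd' _ hF'
      ((hfin k).subset fun x hx => ⟨hx.1, interior_subset hx.2.1, hx.2.2⟩)
    simp only [SetLike.mem_coe] at this
    rw [this, eval_finsetSum, Nat.cast_sum, Finset.mul_sum]
    exact Finset.sum_congr rfl fun T _ => (hp T k hk).2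

end ConeReciprocity

section Homogenization

variable {W ι : Type*} [NormedAddCommGroup W] [NormedSpace ℝ W] {a : ι → W} {i₀ : ι}

/-- The points `a i`, with `a i₀` taken as origin, placed at height one. -/
def heightOnePoint (a : ι → W) (i₀ : ι) (i : ι) : vectorSpan ℝ (Set.range a) × ℝ :=
  (⟨a i - a i₀, vsub_mem_vectorSpan ℝ (Set.mem_range_self i) (Set.mem_range_self i₀)⟩, 1)

/-- The linear map sending `heightOnePoint a i₀ i` to `a i`. -/
def dehomogenize (a : ι → W) (i₀ : ι) : vectorSpan ℝ (Set.range a) × ℝ →ₗ[ℝ] W :=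
  (vectorSpan ℝ (Set.range a)).subtype.coprod (LinearMap.toSpanSingleton ℝ W (a i₀))

theorem dehomogenize_apply (x : vectorSpan ℝ (Set.range a) × ℝ) :
    dehomogenize a i₀ x = x.1 + x.2 • a i₀ := by
  simp [dehomogenize]

theorem dehomogenize_heightOnePoint (i : ι) : dehomogenize a i₀ (heightOnePoint a i₀ i) = a i := by
  simp [dehomogenize_apply, heightOnePoint]

theorem dehomogenize_injective_of_snd_eq {x y : vectorSpan ℝ (Set.range a) × ℝ}
    (h : x.2 = y.2) (hxy : dehomogenize a i₀ x = dehomogenize a i₀ y) : x = y := by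
  rw [dehomogenize_apply, dehomogenize_apply, h] at hxy
  exact Prod.ext (Subtype.ext (add_right_cancel hxy)) h

theorem span_heightOnePoint_eq_top :
    Submodule.span ℝ (Set.range (heightOnePoint a i₀)) = ⊤ := by
  set M := Submodule.span ℝ (Set.range (heightOnePoint a i₀)) with hM
  have hmem : ∀ i, heightOnePoint a i₀ i ∈ M := fun i => Submodule.subset_span ⟨i, rfl⟩
  have h0 : heightOnePoint a i₀ i₀ = (0, 1) := by simp [heightOnePoint]
  have hle : vectorSpan ℝ (Set.range a) ≤
      (M.comap (LinearMap.inl ℝ _ ℝ)).map (vectorSpan ℝ (Set.range a)).subtype := by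
    refine (vectorSpan_eq_span_vsub_set_right ℝ (Set.mem_range_self i₀)).le.trans
      (Submodule.span_le.2 ?_)
    rintro _ ⟨_, ⟨i, rfl⟩, rfl⟩
    refine ⟨(heightOnePoint a i₀ i).1, ?_, rfl⟩
    have := M.sub_mem (hmem i) (hmem i₀)
    rw [h0] at this
    simpa [heightOnePoint] using this
  rw [eq_top_iff]
  rintro ⟨u, t⟩ -
  obtain ⟨u', hu', hu⟩ := hle u.2
  obtain rfl : u' = u := Subtype.ext hu
  have h2 := M.add_mem hu' (M.smul_mem t (hmem i₀))
  rw [h0] at h2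
  simpa using h2

theorem mem_convexHull_range_iff [Fintype ι] (z : W) :
    z ∈ convexHull ℝ (Set.range a) ↔
      ∃ l : ι → ℝ, (∀ i, 0 ≤ l i) ∧ ∑ i, l i = 1 ∧ ∑ i, l i • a i = z := by
  classical
  constructor
  · intro hz
    refine convexHull_min (t := {z | ∃ l : ι → ℝ, (∀ i, 0 ≤ l i) ∧ ∑ i, l i = 1 ∧
      ∑ i, l i • a i = z}) ?_ ?_ hz
    · rintro _ ⟨i, rfl⟩
      refine ⟨Pi.single i 1, fun j => ?_, by simp, by simp [Pi.single_apply]⟩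
      rw [Pi.single_apply]
      split_ifs <;> norm_num
    · rintro _ ⟨l, hl, hl1, rfl⟩ _ ⟨m, hm, hm1, rfl⟩ c e hc he hce
      refine ⟨fun i => c * l i + e * m i,
        fun i => add_nonneg (mul_nonneg hc (hl i)) (mul_nonneg he (hm i)), ?_, ?_⟩
      · rw [Finset.sum_add_distrib, ← Finset.mul_sum, ← Finset.mul_sum, hl1, hm1]
        simpa using hce
      · simp only [add_smul, mul_smul, Finset.sum_add_distrib, Finset.smul_sum]
  · rintro ⟨l, hl, hl1, rfl⟩
    exact (convex_convexHull ℝ _).sum_mem (fun i _ => hl i) hl1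
      fun i _ => subset_convexHull ℝ _ ⟨i, rfl⟩

theorem mem_generatedCone_heightOnePoint_iff_of_snd_eq_one [Fintype ι]
    {x : vectorSpan ℝ (Set.range a) × ℝ} (hx : x.2 = 1) :
    x ∈ generatedCone (heightOnePoint a i₀) ↔
      dehomogenize a i₀ x ∈ convexHull ℝ (Set.range a) := by
  have h2 : ∀ l : ι → ℝ, (∑ i, l i • heightOnePoint a i₀ i).2 = ∑ i, l i := by
    intro l
    simp [Prod.snd_sum, heightOnePoint]
  have h1 : ∀ l : ι → ℝ, dehomogenize a i₀ (∑ i, l i • heightOnePoint a i₀ i) = ∑ i, l i • a i := by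
    intro l
    simp only [map_sum, map_smul, dehomogenize_heightOnePoint]
  rw [mem_convexHull_range_iff]
  constructor
  · rintro ⟨l, hl, rfl⟩
    exact ⟨l, hl, by rw [← h2, hx], (h1 l).symm⟩
  · rintro ⟨l, hl, hl1, hlx⟩
    refine ⟨l, hl, dehomogenize_injective_of_snd_eq (i₀ := i₀) ?_ ?_⟩
    · rw [h2, hl1, hx]
    · rw [h1, hlx]

theorem mem_smul_iff_inv_smul_mem_of_cone {X : Set W} {k : ℝ} (hk : 0 < k)
    (x : vectorSpan ℝ (Set.range a) × ℝ) :
    dehomogenize a i₀ x ∈ k • X ↔ dehomogenize a i₀ (k⁻¹ • x) ∈ X := by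
  rw [Set.mem_smul_set_iff_inv_smul_mem₀ hk.ne', map_smul]

theorem inv_smul_mem_generatedCone_iff {F : Type*} [AddCommGroup F] [Module ℝ F] [Fintype ι]
    {v : ι → F} {k : ℝ} (hk : 0 < k) (x : F) :
    k⁻¹ • x ∈ generatedCone v ↔ x ∈ generatedCone v := by
  refine ⟨fun h => ?_, fun h => generatedCone_smul_mem h (inv_pos.2 hk).le⟩
  have := generatedCone_smul_mem h hk.le
  rwa [smul_inv_smul₀ hk.ne'] at this

theorem inv_smul_mem_interior_generatedCone_iff {F : Type*} [NormedAddCommGroup F]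
    [NormedSpace ℝ F] [Fintype ι] {v : ι → F} {k : ℝ} (hk : 0 < k) (x : F) :
    k⁻¹ • x ∈ interior (generatedCone v) ↔ x ∈ interior (generatedCone v) := by
  have h1 : k • generatedCone v = generatedCone v := by
    ext y
    rw [Set.mem_smul_set_iff_inv_smul_mem₀ hk.ne', inv_smul_mem_generatedCone_iff hk]
  rw [← Set.mem_smul_set_iff_inv_smul_mem₀ hk.ne', ← interior_smul₀ hk.ne', h1]

theorem mem_generatedCone_heightOnePoint_iff [Fintype ι] {k : ℝ} (hk : 0 < k)
    {x : vectorSpan ℝ (Set.range a) × ℝ} (hx : x.2 = k) :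
    x ∈ generatedCone (heightOnePoint a i₀) ↔
      dehomogenize a i₀ x ∈ k • convexHull ℝ (Set.range a) := by
  rw [mem_smul_iff_inv_smul_mem_of_cone hk, ← mem_generatedCone_heightOnePoint_iff_of_snd_eq_one,
    inv_smul_mem_generatedCone_iff hk]
  simp [hx, hk.ne']

theorem dehomogenize_mem_affineSpan {x : vectorSpan ℝ (Set.range a) × ℝ} (hx : x.2 = 1) :
    dehomogenize a i₀ x ∈ affineSpan ℝ (convexHull ℝ (Set.range a)) := by
  rw [affineSpan_convexHull, dehomogenize_apply, hx, one_smul]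
  refine AffineSubspace.vadd_mem_of_mem_direction ?_
    (mem_affineSpan ℝ (Set.mem_range_self i₀))
  rw [direction_affineSpan]
  exact x.1.2

theorem sub_mem_vectorSpan_of_mem_affineSpan {y : W}
    (hy : y ∈ affineSpan ℝ (convexHull ℝ (Set.range a))) :
    y - a i₀ ∈ vectorSpan ℝ (Set.range a) := by
  rw [affineSpan_convexHull] at hy
  rw [← direction_affineSpan]
  exact AffineSubspace.vsub_mem_direction hy (mem_affineSpan ℝ (Set.mem_range_self i₀))

theorem mem_interior_heightOnePoint_iff_of_snd_eq_one [Fintype ι]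
    {x : vectorSpan ℝ (Set.range a) × ℝ} (hx : x.2 = 1) :
    x ∈ interior (generatedCone (heightOnePoint a i₀)) ↔
      dehomogenize a i₀ x ∈ intrinsicInterior ℝ (convexHull ℝ (Set.range a)) := by
  rw [mem_intrinsicInterior, mem_interior_iff_mem_nhds]
  constructor
  · intro h
    let j : affineSpan ℝ (convexHull ℝ (Set.range a)) → vectorSpan ℝ (Set.range a) × ℝ :=
      fun y => (⟨y - a i₀, sub_mem_vectorSpan_of_mem_affineSpan y.2⟩, 1)
    have hj : Continuous j := by fun_prop
    have hdj : ∀ y, dehomogenize a i₀ (j y) = y := by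
      intro y
      simp [j, dehomogenize_apply]
    refine ⟨⟨_, dehomogenize_mem_affineSpan hx⟩, ?_, rfl⟩
    rw [mem_interior_iff_mem_nhds]
    have hjx : j ⟨_, dehomogenize_mem_affineSpan hx⟩ = x :=
      dehomogenize_injective_of_snd_eq (i₀ := i₀) hx.symm (hdj _)
    have h1 := hj.continuousAt.preimage_mem_nhds (by rw [hjx]; exact h)
    filter_upwards [h1] with y hy
    have h2 := (mem_generatedCone_heightOnePoint_iff_of_snd_eq_one rfl).1 hy
    rwa [hdj] at h2
  · rintro ⟨y, hy, hyx⟩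
    have hmem : ∀ z : vectorSpan ℝ (Set.range a) × ℝ,
        dehomogenize a i₀ (z.2⁻¹ • z.1, (1 : ℝ)) ∈ affineSpan ℝ (convexHull ℝ (Set.range a)) :=
      fun z => dehomogenize_mem_affineSpan rfl
    let e : vectorSpan ℝ (Set.range a) × ℝ → affineSpan ℝ (convexHull ℝ (Set.range a)) :=
      fun z => ⟨_, hmem z⟩
    have hx0 : x.2 ≠ 0 := by rw [hx]; exact one_ne_zero
    have he : ContinuousAt e x := by
      rw [Topology.IsInducing.subtypeVal.continuousAt_iff]
      have h1 : ContinuousAt (fun z : vectorSpan ℝ (Set.range a) × ℝ =>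
          ((z.2⁻¹ • z.1 : vectorSpan ℝ (Set.range a)) : W) + a i₀) x := by
        have h2 : ContinuousAt (fun z : vectorSpan ℝ (Set.range a) × ℝ => z.2⁻¹) x :=
          continuousAt_snd.inv₀ hx0
        exact (continuous_subtype_val.continuousAt.comp (h2.smul continuousAt_fst)).add
          continuousAt_const
      refine h1.congr (Filter.Eventually.of_forall fun z => ?_)
      simp [e, dehomogenize_apply]
    have hex : e x = y := by
      refine Subtype.ext (Eq.trans ?_ hyx.symm)
      simp [e, dehomogenize_apply, hx]
    have h3 := he.preimage_mem_nhds (by rw [hex]; exact mem_interior_iff_mem_nhds.1 hy)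
    have h4 : ∀ᶠ z in nhds x, 0 < z.2 :=
      continuousAt_snd.eventually (lt_mem_nhds (by rw [hx]; exact one_pos))
    filter_upwards [h3, h4] with z hz hz0
    rw [← inv_smul_mem_generatedCone_iff hz0]
    have h5 : z.2⁻¹ • z = (z.2⁻¹ • z.1, (1 : ℝ)) := by
      refine Prod.ext rfl ?_
      simp [hz0.ne']
    rw [h5]
    exact (mem_generatedCone_heightOnePoint_iff_of_snd_eq_one rfl).2 hz

theorem mem_interior_heightOnePoint_iff [Fintype ι] {k : ℝ} (hk : 0 < k)
    {x : vectorSpan ℝ (Set.range a) × ℝ} (hx : x.2 = k) :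
    x ∈ interior (generatedCone (heightOnePoint a i₀)) ↔
      dehomogenize a i₀ x ∈ k • intrinsicInterior ℝ (convexHull ℝ (Set.range a)) := by
  rw [mem_smul_iff_inv_smul_mem_of_cone hk, ← mem_interior_heightOnePoint_iff_of_snd_eq_one,
    inv_smul_mem_interior_generatedCone_iff hk]
  simp [hx, hk.ne']

end Homogenization

section LatticePoints

variable {n : ℕ}

/-- The integer points of `ℝ^n`, seen in the homogenization of a family of integer points. -/
def homogeneousLattice {ι : Type*} (a : ι → Fin n → ℤ) (i₀ : ι) :
    AddSubgroup (vectorSpan ℝ (Set.range fun i j => (a i j : ℝ)) × ℝ) where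
  carrier := {x | (∃ y : Fin n → ℤ,
    dehomogenize (fun i j => (a i j : ℝ)) i₀ x = fun j => (y j : ℝ)) ∧
    ∃ z : ℤ, x.2 = z}
  zero_mem' := ⟨⟨0, by rw [map_zero]; ext; simp⟩, 0, by simp⟩
  add_mem' := by
    rintro x x' ⟨⟨y, hy⟩, z, hz⟩ ⟨⟨y', hy'⟩, z', hz'⟩
    exact ⟨⟨y + y', by rw [map_add, hy, hy']; ext; simp⟩, z + z', by simp [hz, hz']⟩
  neg_mem' := by
    rintro x ⟨⟨y, hy⟩, z, hz⟩
    exact ⟨⟨-y, by rw [map_neg, hy]; ext; simp⟩, -z, by simp [hz]⟩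

theorem intCast_injective : Function.Injective fun (y : Fin n → ℤ) (j : Fin n) => (y j : ℝ) := by
  intro y y' h
  funext j
  have h1 : (y j : ℝ) = y' j := congrFun h j
  exact_mod_cast h1

theorem finite_integer_points_of_isBounded {X : Set (Fin n → ℝ)} (hX : Bornology.IsBounded X) :
    {y : Fin n → ℤ | (fun j => (y j : ℝ)) ∈ X}.Finite := by
  obtain ⟨M, hM⟩ := hX.exists_norm_le
  refine (Set.finite_Icc (fun _ : Fin n => -⌈M⌉) (fun _ => ⌈M⌉)).subset fun y hy => ?_
  have h1 : ∀ j, |(y j : ℝ)| ≤ (⌈M⌉ : ℤ) := fun j =>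
    (norm_le_pi_norm (fun j => (y j : ℝ)) j).trans ((hM _ hy).trans (Int.le_ceil M))
  constructor
  · intro j
    have := (abs_le.1 (h1 j)).1
    exact_mod_cast this
  · intro j
    have := (abs_le.1 (h1 j)).2
    exact_mod_cast this

theorem image_dehomogenize_slice {ι : Type*} (a : ι → Fin n → ℤ) (i₀ : ι) (k : ℕ)
    (X : Set (vectorSpan ℝ (Set.range fun i j => (a i j : ℝ)) × ℝ)) (Y : Set (Fin n → ℝ))
    (hXY : ∀ x : vectorSpan ℝ (Set.range fun i j => (a i j : ℝ)) × ℝ, x.2 = (k : ℝ) →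
      (x ∈ X ↔ dehomogenize (fun i j => (a i j : ℝ)) i₀ x ∈ Y))
    (hY : ∀ y ∈ Y, y - (k : ℝ) • (fun j => (a i₀ j : ℝ)) ∈
      vectorSpan ℝ (Set.range fun i j => (a i j : ℝ))) :
    dehomogenize (fun i j => (a i j : ℝ)) i₀ ''
      {x | x ∈ homogeneousLattice a i₀ ∧ x ∈ X ∧ LinearMap.snd ℝ _ ℝ x = k} =
    (fun (y : Fin n → ℤ) (j : Fin n) => (y j : ℝ)) '' {y | (fun j => (y j : ℝ)) ∈ Y} := by
  ext z
  constructor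
  · rintro ⟨x, ⟨⟨⟨y, hy⟩, -⟩, hxX, hxk⟩, rfl⟩
    refine ⟨y, ?_, hy.symm⟩
    have := (hXY x hxk).1 hxX
    rwa [hy] at this
  · rintro ⟨y, hy, rfl⟩
    have h1 : dehomogenize (fun i j => (a i j : ℝ)) i₀ (⟨_, hY _ hy⟩, (k : ℝ)) =
        fun j => (y j : ℝ) := by
      simp [dehomogenize_apply]
    refine ⟨(⟨_, hY _ hy⟩, (k : ℝ)), ⟨⟨⟨y, h1⟩, k, by simp⟩, ?_, rfl⟩, h1⟩
    rw [hXY _ rfl, h1]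
    exact hy

theorem injOn_dehomogenize_slice {W ι : Type*} [NormedAddCommGroup W] [NormedSpace ℝ W]
    (a : ι → W) (i₀ : ι) (k : ℝ) (X : Set (vectorSpan ℝ (Set.range a) × ℝ))
    (hX : ∀ x ∈ X, x.2 = k) : Set.InjOn (dehomogenize a i₀) X :=
  fun x hx y hy h => dehomogenize_injective_of_snd_eq ((hX x hx).trans (hX y hy).symm) h

/-- Ehrhart polynomials of lattice polytopes exist and satisfy reciprocity. -/
theorem exists_ehrhart_polynomial {ι : Type*} [Fintype ι] [Nonempty ι] (a : ι → Fin n → ℤ) :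
    ∃ p : ℚ[X], ∀ k : ℕ, 0 < k →
      p.eval (k : ℚ) = {y : Fin n → ℤ | (fun j => (y j : ℝ)) ∈
        (k : ℝ) • convexHull ℝ (Set.range fun i j => (a i j : ℝ))}.ncard ∧
      p.eval (-(k : ℚ)) =
        (-1) ^ finrank ℝ (vectorSpan ℝ (Set.range fun i j => (a i j : ℝ))) *
        ({y : Fin n → ℤ | (fun j => (y j : ℝ)) ∈ (k : ℝ) • intrinsicInterior ℝ
          (convexHull ℝ (Set.range fun i j => (a i j : ℝ)))}.ncard : ℚ) := by
  obtain ⟨i₀⟩ := ‹Nonempty ι›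
  set A : ι → Fin n → ℝ := fun i j => (a i j : ℝ) with hA
  have hsub : ∀ k : ℕ, 0 < k → ∀ y ∈ (k : ℝ) • convexHull ℝ (Set.range A),
      y - (k : ℝ) • A i₀ ∈ vectorSpan ℝ (Set.range A) := by
    rintro k - _ ⟨z, hz, rfl⟩
    have := (vectorSpan ℝ (Set.range A)).smul_mem (k : ℝ)
      (sub_mem_vectorSpan_of_mem_affineSpan (i₀ := i₀) (subset_affineSpan ℝ _ hz))
    rwa [smul_sub] at this
  have himage := fun k (hk : 0 < k) => image_dehomogenize_slice a i₀ k
    (generatedCone (heightOnePoint A i₀)) ((k : ℝ) • convexHull ℝ (Set.range A))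
    (fun x hx => mem_generatedCone_heightOnePoint_iff (Nat.cast_pos.2 hk) hx) (hsub k hk)
  have himage' := fun k (hk : 0 < k) => image_dehomogenize_slice a i₀ k
    (interior (generatedCone (heightOnePoint A i₀)))
    ((k : ℝ) • intrinsicInterior ℝ (convexHull ℝ (Set.range A)))
    (fun x hx => mem_interior_heightOnePoint_iff (Nat.cast_pos.2 hk) hx)
    (fun y hy => hsub k hk y (Set.smul_set_mono intrinsicInterior_subset hy))
  have hinj := fun (k : ℕ) (X : Set (vectorSpan ℝ (Set.range A) × ℝ)) =>
    injOn_dehomogenize_slice A i₀ k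
      {x | x ∈ homogeneousLattice a i₀ ∧ x ∈ X ∧ LinearMap.snd ℝ _ ℝ x = k} fun x hx => hx.2.2
  have hbdd : Bornology.IsBounded (convexHull ℝ (Set.range A)) :=
    ((Set.finite_range A).isCompact_convexHull ℝ).isBounded
  have hfin : ∀ k : ℕ, {x | x ∈ homogeneousLattice a i₀ ∧
      x ∈ generatedCone (heightOnePoint A i₀) ∧ LinearMap.snd ℝ _ ℝ x = k}.Finite := by
    intro k
    rcases Nat.eq_zero_or_pos k with rfl | hk
    · refine (Set.finite_singleton 0).subset ?_
      rintro x ⟨-, ⟨l, hl, rfl⟩, hx0⟩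
      have h1 : ∑ i, l i = 0 := by
        simpa [Prod.snd_sum, heightOnePoint] using hx0
      have h2 := (Finset.sum_eq_zero_iff_of_nonneg fun i _ => hl i).1 h1
      exact Finset.sum_eq_zero fun i hi => by rw [h2 i hi, zero_smul]
    · refine Set.Finite.of_finite_image ?_ (hinj k _)
      rw [himage k hk]
      exact (finite_integer_points_of_isBounded (hbdd.smul₀ (k : ℝ))).image _
  obtain ⟨p, hp⟩ := exists_polynomial_generatedCone (v := heightOnePoint A i₀) (LinearMap.snd ℝ _ ℝ)
    (fun i => rfl) span_heightOnePoint_eq_top (homogeneousLattice a i₀)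
    (fun i => ⟨⟨a i, dehomogenize_heightOnePoint i⟩, 1, by simp [heightOnePoint]⟩)
    (fun x hx => hx.2) hfin (finrank ℝ (vectorSpan ℝ (Set.range A))) (by simp)
  refine ⟨p, fun k hk => ⟨?_, ?_⟩⟩
  · rw [(hp k hk).1, ← (hinj k _).ncard_image, himage k hk,
      Set.ncard_image_of_injective _ intCast_injective]
  · rw [(hp k hk).2, ← (hinj k _).ncard_image, himage' k hk,
      Set.ncard_image_of_injective _ intCast_injective]

end LatticePoints

/-- Ehrhart–Macdonald reciprocity: evaluating the Ehrhart polynomial of an integral polytope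
`P` of dimension `d` at `-k` gives, up to the sign `(-1)^d`, the number of integer points in
the `k`-th dilate of the relative interior of `P`. -/
theorem ehrhart_macdonald_reciprocity
    (n : ℕ) (S : Finset (Fin n → ℤ)) (hS : S.Nonempty)
    (P : Set (Fin n → ℝ))
    (hP : P = convexHull ℝ ((fun y : Fin n → ℤ => fun i => (y i : ℝ)) '' ↑S))
    (d : ℕ) (hd : d = Module.finrank ℝ (affineSpan ℝ P).direction)
    (p : Polynomial ℚ)
    (hp : ∀ k : ℕ, 0 < k →
      p.eval (k : ℚ) =
        (Set.ncard {x : Fin n → ℤ | (fun i => (x i : ℝ)) ∈ (k : ℝ) • P} : ℚ)) :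
    ∀ k : ℕ, 0 < k →
      p.eval (-(k : ℚ)) =
        (-1 : ℚ) ^ d *
          (Set.ncard {x : Fin n → ℤ |
            (fun i => (x i : ℝ)) ∈ (k : ℝ) • intrinsicInterior ℝ P} : ℚ) := by
  classical
  have : Nonempty S := hS.to_subtype
  have hrange : ((fun y : Fin n → ℤ => fun i => (y i : ℝ)) '' ↑S) =
      Set.range fun (s : S) (j : Fin n) => (s.1 j : ℝ) := by
    rw [Set.image_eq_range]
    rfl
  rw [hrange] at hP
  obtain ⟨q, hq⟩ := exists_ehrhart_polynomial fun s : S => s.1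
  have hpq : p = q := by
    refine eq_of_infinite_eval_eq p q
      (((Set.Ioi_infinite 0).image (Nat.cast_injective (R := ℚ)).injOn).mono ?_)
    rintro _ ⟨k, hk, rfl⟩
    show p.eval (k : ℚ) = q.eval (k : ℚ)
    rw [hp k hk, (hq k hk).1, hP]
  intro k hk
  rw [hpq, (hq k hk).2, hd, hP, affineSpan_convexHull, direction_affineSpan]
end

section
/- Let v_1, …, v_d ∈ ℤ^n be linearly independent, suppose every v_i has last coordinate equal to a fixed positive integer ℓ, and for each integer i ≥ 0 let h*_i denote the number of points of ℤ^n ∩ Π(v_1,…,v_d) whose last coordinate equals i. Then for all integers k ≥ 0 and 0 ≤ r < ℓ, the number of points of ℤ^n ∩ cone_ℝ(v_1,…,v_d) with last coordinate equal to ℓ·k + r equals Σ_{j=0}^{d−1} h*_{j·ℓ+r} · C(k+d−1−j, d−1). -/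
/-- The real coordinate vector of an integer vector. -/
def toReal {n : ℕ} (x : Fin n → ℤ) : Fin n → ℝ := fun j => (x j : ℝ)

/-- The real cone generated by the vectors `v i`. -/
def coneR {n d : ℕ} (v : Fin d → (Fin n → ℤ)) : Set (Fin n → ℝ) :=
  {y | ∃ lam : Fin d → ℝ, (∀ i, 0 ≤ lam i) ∧ y = ∑ i, lam i • toReal (v i)}

/-- The (half-open) fundamental parallelepiped of the vectors `v i`. -/
def fundPar {n d : ℕ} (v : Fin d → (Fin n → ℤ)) : Set (Fin n → ℝ) :=
  {y | ∃ lam : Fin d → ℝ, (∀ i, 0 ≤ lam i ∧ lam i < 1) ∧ y = ∑ i, lam i • toReal (v i)}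

theorem card_piAntidiag_univ_nat (d m : ℕ) (hd : 0 < d) :
    (Finset.piAntidiag (Finset.univ : Finset (Fin d)) m).card = (m + d - 1).choose (d - 1) := by
  have h : (Finset.piAntidiag (Finset.univ : Finset (Fin d)) m).card =
      Fintype.card (Sym (Fin d) m) := by
    rw [← Nat.card_eq_fintype_card, Nat.card_congr (Sym.equivNatSumOfFintype (Fin d) m),
      Nat.subtype_card]
    simp
  rw [h, Sym.card_sym_eq_choose, Fintype.card_fin, add_comm d m]
  exact Nat.choose_symm_of_eq_add (by omega)

theorem toReal_add_sum_smul {n d : ℕ} (v : Fin d → (Fin n → ℤ)) (p : Fin n → ℤ)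
    (m : Fin d → ℕ) :
    toReal (p + ∑ i, m i • v i) = toReal p + ∑ i, (m i : ℝ) • toReal (v i) := by
  ext a
  simp [toReal]

theorem last_add_sum_smul {n d : ℕ} {v : Fin d → (Fin (n + 1) → ℤ)} {ℓ : ℕ}
    (hlast : ∀ i, v i (Fin.last n) = (ℓ : ℤ)) (p : Fin (n + 1) → ℤ) (m : Fin d → ℕ) :
    (p + ∑ i, m i • v i) (Fin.last n) = p (Fin.last n) + ℓ * ((∑ i, m i : ℕ) : ℤ) := by
  simp [hlast, Finset.mul_sum, mul_comm]

theorem last_eq_mul_sum {n d : ℕ} {v : Fin d → (Fin (n + 1) → ℤ)} {ℓ : ℕ}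
    (hlast : ∀ i, v i (Fin.last n) = (ℓ : ℤ)) {p : Fin (n + 1) → ℤ} {lam : Fin d → ℝ}
    (hp : toReal p = ∑ i, lam i • toReal (v i)) :
    (p (Fin.last n) : ℝ) = ℓ * ∑ i, lam i := by
  have := congrFun hp (Fin.last n)
  simpa [toReal, hlast, ← Finset.sum_mul, mul_comm] using this

/-- The fundamental parallelepiped contains finitely many integer points. -/
theorem finite_toReal_mem_fundPar {n d : ℕ} (v : Fin d → (Fin n → ℤ)) :
    {x : Fin n → ℤ | toReal x ∈ fundPar v}.Finite := by
  refine (Set.finite_Icc (fun a => -∑ i, |v i a|) (fun a => ∑ i, |v i a|)).subset ?_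
  rintro x ⟨lam, hlam, hx⟩
  have key : ∀ a, |x a| ≤ ∑ i, |v i a| := fun a => by
    have hxa : (x a : ℝ) = ∑ i, lam i * (v i a : ℝ) := by
      simpa [toReal] using congrFun hx a
    have : |(x a : ℝ)| ≤ ∑ i, |(v i a : ℝ)| := by
      rw [hxa]
      refine (Finset.abs_sum_le_sum_abs _ _).trans (Finset.sum_le_sum fun i _ => ?_)
      rw [abs_mul, abs_of_nonneg (hlam i).1]
      exact mul_le_of_le_one_left (abs_nonneg _) (hlam i).2.le
    exact_mod_cast this
  exact ⟨fun a => (abs_le.1 (key a)).1, fun a => (abs_le.1 (key a)).2⟩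

/-- Translates of the fundamental parallelepiped by distinct natural combinations of the
generators are disjoint. -/
theorem injOn_add_sum_smul {n d : ℕ} {v : Fin d → (Fin n → ℤ)}
    (hli : LinearIndependent ℝ (fun i => toReal (v i))) :
    Set.InjOn (fun q : (Fin n → ℤ) × (Fin d → ℕ) => q.1 + ∑ i, q.2 i • v i)
      {q | toReal q.1 ∈ fundPar v} := by
  rintro ⟨p, m⟩ ⟨lam, hlam, hp⟩ ⟨p', m'⟩ ⟨lam', hlam', hp'⟩ h
  have hR : ∑ i, (lam i + m i) • toReal (v i) = ∑ i, (lam' i + m' i) • toReal (v i) := by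
    have := congrArg toReal h
    simp only [toReal_add_sum_smul] at this hp hp'
    simpa only [add_smul, Finset.sum_add_distrib, hp, hp'] using this
  have hcoef := linearIndependent_iff_injective_fintypeLinearCombination.1 hli
    (a₁ := fun i => lam i + m i) (a₂ := fun i => lam' i + m' i)
    (by simpa [Fintype.linearCombination_apply] using hR)
  have hm : m = m' := funext fun i => by
    have hi : lam i + m i = lam' i + m' i := congrFun hcoef i
    have h1 := hlam i
    have h2 := hlam' i
    have a1 : (m i : ℝ) < m' i + 1 := by linarith
    have a2 : (m' i : ℝ) < m i + 1 := by linarith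
    norm_cast at a1 a2
    omega
  subst hm
  simpa using h

/-- The integer points of the cone at height `ℓ * k + r` decompose uniquely as integer points
of the fundamental parallelepiped plus natural combinations of the generators. -/
theorem toReal_mem_coneR_level_iff {n d : ℕ} {v : Fin d → (Fin (n + 1) → ℤ)} {ℓ : ℕ}
    (hd : 0 < d) (hℓ : 0 < ℓ) (hlast : ∀ i, v i (Fin.last n) = (ℓ : ℤ)) {k r : ℕ} (hr : r < ℓ)
    (x : Fin (n + 1) → ℤ) :
    (toReal x ∈ coneR v ∧ x (Fin.last n) = (ℓ : ℤ) * k + r) ↔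
      ∃ j < d, ∃ p : Fin (n + 1) → ℤ, ∃ m : Fin d → ℕ,
        (toReal p ∈ fundPar v ∧ p (Fin.last n) = ((j * ℓ + r : ℕ) : ℤ)) ∧
          j + ∑ i, m i = k ∧ p + ∑ i, m i • v i = x := by
  constructor
  · rintro ⟨⟨lam, hlam, hx⟩, hxl⟩
    set m : Fin d → ℕ := fun i => ⌊lam i⌋₊ with hm
    set p := x - ∑ i, m i • v i with hpdef
    have hpx : p + ∑ i, m i • v i = x := sub_add_cancel _ _
    have hp : toReal p = ∑ i, (lam i - m i) • toReal (v i) := by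
      have := toReal_add_sum_smul v p m
      rw [hpx, hx] at this
      rw [← sub_eq_of_eq_add this]
      simp only [sub_smul, Finset.sum_sub_distrib]
    have hfrac : ∀ i, 0 ≤ lam i - m i ∧ lam i - m i < 1 := fun i =>
      ⟨sub_nonneg.2 (Nat.floor_le (hlam i)), by
        have := Nat.lt_floor_add_one (lam i)
        simp only [hm]
        linarith⟩
    have hpl := last_eq_mul_sum hlast hp
    have hℓ' : (0 : ℝ) < ℓ := by exact_mod_cast hℓ
    have hlow : 0 ≤ p (Fin.last n) := by
      have : (0 : ℝ) ≤ p (Fin.last n) := by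
        rw [hpl]
        exact mul_nonneg hℓ'.le (Finset.sum_nonneg fun i _ => (hfrac i).1)
      exact_mod_cast this
    have hupp : p (Fin.last n) < ℓ * d := by
      have hsum : ∑ i, (lam i - m i) < d := by
        have : ∑ i, (lam i - m i) < ∑ _i : Fin d, (1 : ℝ) :=
          Finset.sum_lt_sum_of_nonempty ⟨⟨0, hd⟩, Finset.mem_univ _⟩ fun i _ => (hfrac i).2
        simpa using this
      have : (p (Fin.last n) : ℝ) < ℓ * d := by
        rw [hpl]
        exact mul_lt_mul_of_pos_left hsum hℓ'
      exact_mod_cast this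
    have hht := last_add_sum_smul hlast p m
    rw [hpx, hxl] at hht
    have hle : ∑ i, m i ≤ k := by
      by_contra! hlt
      have : (ℓ : ℤ) * (k + 1) ≤ ℓ * ((∑ i, m i : ℕ) : ℤ) := by gcongr; exact_mod_cast hlt
      have : (r : ℤ) < ℓ := by exact_mod_cast hr
      linarith
    obtain ⟨j, hj⟩ := Nat.exists_eq_add_of_le' hle
    have hpj : p (Fin.last n) = ((j * ℓ + r : ℕ) : ℤ) := by
      rw [hj] at hht
      push_cast at hht ⊢
      linarith
    refine ⟨j, ?_, p, m, ⟨⟨_, hfrac, hp⟩, hpj⟩, hj.symm, hpx⟩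
    rw [hpj] at hupp
    have : j * ℓ + r < ℓ * d := by exact_mod_cast hupp
    by_contra! hdj
    have := Nat.mul_le_mul_left ℓ hdj
    linarith [mul_comm ℓ j]
  · rintro ⟨j, -, p, m, ⟨⟨lam, hlam, hp⟩, hpl⟩, hk, rfl⟩
    refine ⟨⟨fun i => lam i + m i, fun i => add_nonneg (hlam i).1 (Nat.cast_nonneg _), ?_⟩, ?_⟩
    · rw [toReal_add_sum_smul, hp]
      simp only [add_smul, Finset.sum_add_distrib]
    · rw [last_add_sum_smul hlast, hpl, ← hk]
      push_cast
      ring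

/-- Counting integer points of a simplicial cone by last coordinate, via the `h*`-numbers:
if all generators have last coordinate `ℓ > 0` and `h* i` counts the integer points of the
fundamental parallelepiped at height `i`, then the number of integer points of the cone at
height `ℓ·k + r` (with `0 ≤ r < ℓ`) is `Σ_{j=0}^{d-1} h*_{j·ℓ+r} · C(k + d - 1 - j, d - 1)`. -/
theorem simplicial_cone_level_count_hstar
    (n d : ℕ) (hd : 0 < d) (v : Fin d → (Fin (n + 1) → ℤ))
    (hli : LinearIndependent ℝ (fun i => toReal (v i)))
    (ℓ : ℕ) (hℓ : 0 < ℓ)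
    (hlast : ∀ i, v i (Fin.last n) = (ℓ : ℤ))
    (hstar : ℕ → ℕ)
    (hhstar : ∀ i : ℕ, hstar i =
      Set.ncard {x : Fin (n + 1) → ℤ | toReal x ∈ fundPar v ∧ x (Fin.last n) = (i : ℤ)}) :
    ∀ k r : ℕ, r < ℓ →
      Set.ncard {x : Fin (n + 1) → ℤ |
          toReal x ∈ coneR v ∧ x (Fin.last n) = (ℓ : ℤ) * k + r} =
        ∑ j ∈ Finset.range d, hstar (j * ℓ + r) * Nat.choose (k + d - 1 - j) (d - 1) := by
  classical
  intro k r hr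
  set P : ℕ → Set (Fin (n + 1) → ℤ) := fun j =>
    {x | toReal x ∈ fundPar v ∧ x (Fin.last n) = ((j * ℓ + r : ℕ) : ℤ)}
  have hP : ∀ j, (P j).Finite := fun j =>
    (finite_toReal_mem_fundPar v).subset fun _ hx => hx.1
  set M : ℕ → Finset (Fin d → ℕ) := fun j =>
    if j ≤ k then Finset.piAntidiag Finset.univ (k - j) else ∅
  have hM : ∀ j m, m ∈ M j ↔ j + ∑ i, m i = k := fun j m => by
    by_cases hjk : j ≤ k
    · have : m ∈ M j ↔ ∑ i, m i = k - j := by simp [M, hjk]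
      rw [this]
      omega
    · simp only [M, hjk, if_false, Finset.notMem_empty, false_iff]
      omega
  have hMcard : ∀ j < d, (M j).card = (k + d - 1 - j).choose (d - 1) := fun j hj => by
    by_cases hjk : j ≤ k
    · simp only [M, hjk, if_true]
      rw [card_piAntidiag_univ_nat _ _ hd]
      congr 1
      omega
    · rw [Nat.choose_eq_zero_of_lt (by omega)]
      simp [M, hjk]
  set T := (Finset.range d).biUnion fun j => (hP j).toFinset ×ˢ M j
  have hS : {x : Fin (n + 1) → ℤ | toReal x ∈ coneR v ∧ x (Fin.last n) = (ℓ : ℤ) * k + r} =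
      (T.image fun q => q.1 + ∑ i, q.2 i • v i : Finset (Fin (n + 1) → ℤ)) := by
    ext x
    rw [Set.mem_ofPred_eq, toReal_mem_coneR_level_iff hd hℓ hlast hr]
    simp only [T, Finset.coe_image, Set.mem_image, Finset.mem_coe, Finset.mem_biUnion,
      Finset.mem_range, Finset.mem_product, Set.Finite.mem_toFinset, hM, Prod.exists]
    constructor
    · rintro ⟨j, hj, p, m, hp, hm, rfl⟩
      exact ⟨p, m, ⟨j, hj, hp, hm⟩, rfl⟩
    · rintro ⟨p, m, ⟨j, hj, hp, hm⟩, rfl⟩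
      exact ⟨j, hj, p, m, hp, hm, rfl⟩
  have hinj : Set.InjOn (fun q : (Fin (n + 1) → ℤ) × (Fin d → ℕ) => q.1 + ∑ i, q.2 i • v i) T := by
    refine (injOn_add_sum_smul hli).mono fun q hq => ?_
    obtain ⟨j, -, hq⟩ := Finset.mem_biUnion.1 hq
    exact ((hP j).mem_toFinset.1 (Finset.mem_product.1 hq).1).1
  have hdisj : ((Finset.range d : Finset ℕ) : Set ℕ).PairwiseDisjoint
      fun j => (hP j).toFinset ×ˢ M j := by
    intro j _ j' _ hne
    refine Finset.disjoint_left.2 fun q hq hq' => hne ?_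
    have h := (hM _ _).1 (Finset.mem_product.1 hq).2
    have h' := (hM _ _).1 (Finset.mem_product.1 hq').2
    omega
  rw [hS, Set.ncard_coe_finset, Finset.card_image_of_injOn hinj, Finset.card_biUnion hdisj]
  refine Finset.sum_congr rfl fun j hj => ?_
  rw [Finset.card_product, hMcard j (Finset.mem_range.1 hj), hhstar,
    ← Set.ncard_eq_toFinset_card _ (hP j)]
end
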